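/- Let k and s be natural numbers with k ≥ 3 and s ≥ k(k−1). Then for every ε > 0 there is a constant C(s,k,ε) such that for all real X ≥ 1 one has J_{s,k}(X) ≤ C(s,k,ε) · X^{2s − k(k+1)/2 + ε}. -/

import Mathlib

/-- `J s k X` counts the 2s-tuples of integers `(x₁,…,x_s,y₁,…,y_s)` with
`1 ≤ xᵢ, yᵢ ≤ X` satisfying `x₁^j + … + x_s^j = y₁^j + … + y_s^j` for `1 ≤ j ≤ k`. -/
noncomputable def J (s k : ℕ) (X : ℝ) : ℕ :=
  Set.ncard {p : (Fin s → ℤ) × (Fin s → ℤ) |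
    (∀ i, 1 ≤ p.1 i ∧ (p.1 i : ℝ) ≤ X) ∧ (∀ i, 1 ≤ p.2 i ∧ (p.2 i : ℝ) ≤ X) ∧
    ∀ j ∈ Finset.Icc 1 k, ∑ i, p.1 i ^ j = ∑ i, p.2 i ^ j}


namespace VMV
open Finset Polynomial

theorem holder_nat {Ω : Type} [Fintype Ω] (w X X1 X2 : Ω → ℝ) (hw : ∀ ω, 0 ≤ w ω)
    (hX : ∀ ω, 0 ≤ X ω) (hX1 : ∀ ω, 0 ≤ X1 ω) (hX2 : ∀ ω, 0 ≤ X2 ω) (i j : ℕ)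
    (hi : 0 < i) (hj : 0 < j) (h : ∀ ω, X ω ^ (i + j) ≤ X1 ω ^ i * X2 ω ^ j) :
    (∑ ω, w ω * X ω) ^ (i + j) ≤ (∑ ω, w ω * X1 ω) ^ i * (∑ ω, w ω * X2 ω) ^ j := by
  have nn : ∀ Y : Ω → ℝ, (∀ ω, 0 ≤ Y ω) → 0 ≤ ∑ ω, w ω * Y ω := fun Y hY =>
    Finset.sum_nonneg fun ω _ => mul_nonneg (hw ω) (hY ω)
  have key : ∀ Y : Ω → ℝ, (∀ ω, 0 ≤ Y ω) → (∀ ω, Y ω = 0 → X ω = 0) → ∑ ω, w ω * Y ω = 0 →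
      ∑ ω, w ω * X ω = 0 := by
    intro Y hY hYX h0
    rw [Finset.sum_eq_zero_iff_of_nonneg (fun ω _ => mul_nonneg (hw ω) (hY ω))] at h0
    refine Finset.sum_eq_zero fun ω hω => ?_
    rcases mul_eq_zero.1 (h0 ω hω) with h1 | h1
    · simp [h1]
    · simp [hYX ω h1]
  have zX : ∀ ω, X1 ω ^ i * X2 ω ^ j = 0 → X ω = 0 := by
    intro ω h0
    have := h ω
    rw [h0] at this
    exact pow_eq_zero_iff (by omega : i + j ≠ 0) |>.1 (le_antisymm this (pow_nonneg (hX ω) _))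
  rcases (nn X1 hX1).eq_or_lt with hA | hA
  · have := key X1 hX1 (fun ω h0 => zX ω (by simp [h0, hi.ne'])) hA.symm
    rw [this, ← hA]; simp [hi.ne']
  rcases (nn X2 hX2).eq_or_lt with hB | hB
  · have := key X2 hX2 (fun ω h0 => zX ω (by simp [h0, hj.ne'])) hB.symm
    rw [this, ← hB]; simp [hj.ne']
  set A := ∑ ω, w ω * X1 ω with hAd
  set B := ∑ ω, w ω * X2 ω with hBd
  set m : ℝ := ((i + j : ℕ) : ℝ) with hm
  have hm0 : 0 < m := by rw [hm]; exact_mod_cast (by omega : 0 < i + j)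
  have hmne : (i + j : ℕ) ≠ 0 := by omega
  set c : ℝ := (A ^ i * B ^ j) ^ (1 / m) with hc
  have hc0 : 0 < c := by positivity
  have hcm : c ^ (i + j) = A ^ i * B ^ j := by
    rw [hc, hm, one_div, Real.rpow_inv_natCast_pow (by positivity) hmne]
  have pt : ∀ ω, X ω ≤ c * ((i : ℝ) / m * (X1 ω / A) + (j : ℝ) / m * (X2 ω / B)) := by
    intro ω
    have h1 := Real.geom_mean_le_arith_mean2_weighted (w₁ := i / m) (w₂ := j / m)
      (p₁ := X1 ω / A) (p₂ := X2 ω / B) (by positivity) (by positivity)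
      (div_nonneg (hX1 ω) hA.le) (div_nonneg (hX2 ω) hB.le)
      (by rw [← add_div, hm]; push_cast; rw [div_self]; push_cast at hm; rw [← hm]; exact hm0.ne')
    refine le_trans ?_ (mul_le_mul_of_nonneg_left h1 hc0.le)
    have h3 : 0 ≤ X1 ω / A := div_nonneg (hX1 ω) hA.le
    have h4 : 0 ≤ X2 ω / B := div_nonneg (hX2 ω) hB.le
    refine le_of_pow_le_pow_left₀ hmne (by positivity) ?_
    have e1 : ((X1 ω / A) ^ ((i : ℝ) / m)) ^ (i + j) = (X1 ω / A) ^ i := by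
      rw [← Real.rpow_natCast, ← Real.rpow_mul h3, ← hm, div_mul_cancel₀ _ hm0.ne', Real.rpow_natCast]
    have e2 : ((X2 ω / B) ^ ((j : ℝ) / m)) ^ (i + j) = (X2 ω / B) ^ j := by
      rw [← Real.rpow_natCast, ← Real.rpow_mul h4, ← hm, div_mul_cancel₀ _ hm0.ne', Real.rpow_natCast]
    rw [mul_pow, mul_pow, e1, e2, hcm, div_pow, div_pow]
    have : A ^ i * B ^ j * (X1 ω ^ i / A ^ i * (X2 ω ^ j / B ^ j)) = X1 ω ^ i * X2 ω ^ j := by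
      field_simp
    rw [this]; exact h ω
  have : ∑ ω, w ω * X ω ≤ c := by
    calc ∑ ω, w ω * X ω ≤ ∑ ω, w ω * (c * ((i : ℝ) / m * (X1 ω / A) + (j : ℝ) / m * (X2 ω / B))) :=
          Finset.sum_le_sum fun ω _ => mul_le_mul_of_nonneg_left (pt ω) (hw ω)
      _ = c * ((i : ℝ) / m / A * A + (j : ℝ) / m / B * B) := by
          rw [hAd, hBd, Finset.mul_sum, Finset.mul_sum, ← Finset.sum_add_distrib, Finset.mul_sum]
          refine Finset.sum_congr rfl fun ω _ => by rw [← hAd, ← hBd]; ring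
      _ = c := by
          rw [div_mul_cancel₀ _ hA.ne', div_mul_cancel₀ _ hB.ne', ← add_div, hm]
          push_cast
          rw [div_self, mul_one]
          push_cast at hm; rw [← hm]; exact hm0.ne'
  calc _ ≤ c ^ (i + j) := pow_le_pow_left₀ (nn X hX) this _
    _ = _ := hcm

/-- weighted L^t norm of a nonnegative function. -/
noncomputable def nt {Ω : Type} [Fintype Ω] (w : Ω → ℝ) (t : ℕ) (G : Ω → ℝ) : ℝ :=
  (∑ ω, w ω * G ω ^ t) ^ (1 / (t : ℝ))

theorem nt_nonneg {Ω : Type} [Fintype Ω] {w : Ω → ℝ} (hw : ∀ ω, 0 ≤ w ω) (t : ℕ) {G : Ω → ℝ}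
    (hG : ∀ ω, 0 ≤ G ω) : 0 ≤ nt w t G :=
  Real.rpow_nonneg (Finset.sum_nonneg fun ω _ => mul_nonneg (hw ω) (pow_nonneg (hG ω) _)) _

theorem nt_pow {Ω : Type} [Fintype Ω] {w : Ω → ℝ} (hw : ∀ ω, 0 ≤ w ω) {t : ℕ} (ht : t ≠ 0) {G : Ω → ℝ}
    (hG : ∀ ω, 0 ≤ G ω) : nt w t G ^ t = ∑ ω, w ω * G ω ^ t := by
  rw [nt, one_div, Real.rpow_inv_natCast_pow _ ht]
  exact Finset.sum_nonneg fun ω _ => mul_nonneg (hw ω) (pow_nonneg (hG ω) _)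

theorem nt_le {Ω : Type} [Fintype Ω] {w : Ω → ℝ} (hw : ∀ ω, 0 ≤ w ω) {t : ℕ} (ht : t ≠ 0) {G : Ω → ℝ}
    (hG : ∀ ω, 0 ≤ G ω) {K : ℝ} (hK : 0 ≤ K) (h : ∑ ω, w ω * G ω ^ t ≤ K ^ t) : nt w t G ≤ K := by
  rw [← nt_pow hw ht hG] at h
  exact le_of_pow_le_pow_left₀ ht hK h

theorem nt_mono {Ω : Type} [Fintype Ω] {w : Ω → ℝ} (hw : ∀ ω, 0 ≤ w ω) {t : ℕ} (ht : t ≠ 0) {G H : Ω → ℝ}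
    (hG : ∀ ω, 0 ≤ G ω) (h : ∀ ω, G ω ≤ H ω) : nt w t G ≤ nt w t H := by
  have hH : ∀ ω, 0 ≤ H ω := fun ω => (hG ω).trans (h ω)
  refine nt_le hw ht hG (nt_nonneg hw t hH) ?_
  rw [nt_pow hw ht hH]
  exact Finset.sum_le_sum fun ω _ => mul_le_mul_of_nonneg_left (pow_le_pow_left₀ (hG ω) (h ω) _) (hw ω)

theorem nt_smul {Ω : Type} [Fintype Ω] {w : Ω → ℝ} (hw : ∀ ω, 0 ≤ w ω) {t : ℕ} (ht : t ≠ 0) {G : Ω → ℝ}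
    (hG : ∀ ω, 0 ≤ G ω) {c : ℝ} (hc : 0 ≤ c) : nt w t (fun ω => c * G ω) ≤ c * nt w t G := by
  refine nt_le hw ht (fun ω => mul_nonneg hc (hG ω)) (mul_nonneg hc (nt_nonneg hw t hG)) ?_
  rw [mul_pow, nt_pow hw ht hG, Finset.mul_sum]
  refine le_of_eq (Finset.sum_congr rfl fun ω _ => by rw [mul_pow]; ring)

theorem nt_add {Ω : Type} [Fintype Ω] {w : Ω → ℝ} (hw : ∀ ω, 0 ≤ w ω) {t : ℕ} (ht : t ≠ 0) {G H : Ω → ℝ}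
    (hG : ∀ ω, 0 ≤ G ω) (hH : ∀ ω, 0 ≤ H ω) :
    nt w t (fun ω => G ω + H ω) ≤ nt w t G + nt w t H := by
  have ht1 : (1 : ℝ) ≤ t := by exact_mod_cast Nat.one_le_iff_ne_zero.2 ht
  have conv : ∀ G : Ω → ℝ, (∀ ω, 0 ≤ G ω) →
      nt w t G = (∑ ω, (w ω ^ (1 / (t : ℝ)) * G ω) ^ (t : ℝ)) ^ (1 / (t : ℝ)) := by
    intro G hG
    unfold nt
    congr 1
    refine Finset.sum_congr rfl fun ω _ => ?_
    rw [Real.rpow_natCast, mul_pow, one_div, Real.rpow_inv_natCast_pow (hw ω) ht]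
  rw [conv G hG, conv H hH, conv _ (fun ω => add_nonneg (hG ω) (hH ω))]
  have := Real.Lp_add_le_of_nonneg (s := Finset.univ) (f := fun ω => w ω ^ (1 / (t : ℝ)) * G ω)
    (g := fun ω => w ω ^ (1 / (t : ℝ)) * H ω) ht1
    (fun ω _ => mul_nonneg (Real.rpow_nonneg (hw ω) _) (hG ω))
    (fun ω _ => mul_nonneg (Real.rpow_nonneg (hw ω) _) (hH ω))
  simpa only [mul_add] using this

theorem nt_sum {Ω : Type} [Fintype Ω] {w : Ω → ℝ} (hw : ∀ ω, 0 ≤ w ω) {t : ℕ} (ht : t ≠ 0)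
    {γ : Type} (C : Finset γ) (G : γ → Ω → ℝ) (hG : ∀ c ω, 0 ≤ G c ω) :
    nt w t (fun ω => ∑ c ∈ C, G c ω) ≤ ∑ c ∈ C, nt w t (G c) := by
  classical
  induction C using Finset.induction_on with
  | empty =>
    simp [nt, ht]
  | insert a C ha ih =>
    simp only [Finset.sum_insert ha]
    refine (nt_add hw ht (hG a) fun ω => Finset.sum_nonneg fun c _ => hG c ω).trans ?_
    gcongr

/-- `n ^ (1/p)` etc.: characters. -/
noncomputable def e (p Q : ℕ) (x : ℤ) : ℂ :=
  Complex.exp (2 * Real.pi * Complex.I * ((x : ℂ) / ((p : ℂ) ^ Q)))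

theorem e_add (p Q : ℕ) (x y : ℤ) : e p Q (x + y) = e p Q x * e p Q y := by
  rw [e, e, e, ← Complex.exp_add]; congr 1; push_cast; ring

theorem e_eq_one_iff {p : ℕ} (hp : p ≠ 0) (Q : ℕ) (x : ℤ) : e p Q x = 1 ↔ (p : ℤ) ^ Q ∣ x := by
  rw [e, Complex.exp_eq_one_iff]
  have hpc : (p : ℂ) ^ Q ≠ 0 := pow_ne_zero _ (by exact_mod_cast hp)
  have h2 : (2 * Real.pi * Complex.I : ℂ) ≠ 0 := Complex.two_pi_I_ne_zero
  constructor
  · rintro ⟨n, hn⟩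
    refine ⟨n, ?_⟩
    rw [mul_comm] at hn
    have := mul_right_cancel₀ h2 hn
    rw [div_eq_iff hpc] at this
    have h3 : (x : ℂ) = (((p : ℤ) ^ Q * n : ℤ) : ℂ) := by push_cast; rw [this]; ring
    exact_mod_cast h3
  · rintro ⟨n, hn⟩
    refine ⟨n, ?_⟩
    rw [hn]; push_cast; field_simp

theorem norm_e (p Q : ℕ) (x : ℤ) : ‖e p Q x‖ = 1 := by
  have : (2 * Real.pi * Complex.I * ((x : ℂ) / ((p : ℂ) ^ Q)) : ℂ)
      = ((2 * Real.pi * ((x : ℝ) / (p : ℝ) ^ Q) : ℝ) : ℂ) * Complex.I := by push_cast; ring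
  rw [e, this, Complex.norm_exp_ofReal_mul_I]

theorem e_congr {p : ℕ} (hp : p ≠ 0) {Q : ℕ} {x y : ℤ} (h : (p : ℤ) ^ Q ∣ x - y) :
    e p Q x = e p Q y := by
  have : x = (x - y) + y := by ring
  rw [this, e_add, (e_eq_one_iff hp Q _).2 h, one_mul]

theorem e_shift {p : ℕ} (hp : p ≠ 0) (Q r : ℕ) (x : ℤ) : e p (Q + r) ((p : ℤ) ^ r * x) = e p Q x := by
  rw [e, e]; congr 1
  have hpc : (p : ℂ) ≠ 0 := by exact_mod_cast hp
  push_cast; field_simp; ring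

end VMV


namespace VMV
open Finset Polynomial

def tri (k : ℕ) : ℕ := k * (k + 1) / 2

theorem two_tri (k : ℕ) : 2 * tri k = k * (k + 1) :=
  Nat.mul_div_cancel' (Nat.even_mul_succ_self k).two_dvd

theorem tri_pos {k : ℕ} (hk : 0 < k) : 0 < tri k := by
  have := two_tri k; nlinarith

theorem tri_lt {l k : ℕ} (h : l < k) : tri l < tri k := by
  have := two_tri k; have := two_tri l; nlinarith

variable {ι Ω : Type} [Fintype Ω]

noncomputable def F (f : ι → Ω → ℂ) (s : Finset ι) (ω : Ω) : ℂ := ∑ i ∈ s, f i ω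

noncomputable def N2 (w : Ω → ℝ) (t : ℕ) (f : ι → Ω → ℂ) (s : Finset ι) : ℝ :=
  nt w t (fun ω => ‖F f s ω‖ ^ 2)

def cl (n : ι → ℤ) (s : Finset ι) (q ξ : ℤ) : Finset ι := s.filter (fun i => n i % q = ξ % q)

noncomputable def S (w : Ω → ℝ) (t : ℕ) (f : ι → Ω → ℂ) (n : ι → ℤ) (s : Finset ι) (q : ℤ) : ℝ :=
  ∑ c ∈ s.image (fun i => n i % q), N2 w t f (cl n s q c)

structure Sys (p k Q : ℕ) (s : Finset ι) (n : ι → ℤ) (f : ι → Ω → ℂ) (w : Ω → ℝ) : Prop where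
  nonneg : ∀ ω, 0 ≤ w ω
  act : ∀ P : ℤ[X], P.natDegree ≤ k → ∃ T : Equiv.Perm Ω, (∀ ω, w (T ω) = w ω) ∧
    ∀ i ∈ s, ∀ ω, f i (T ω) = e p Q (P.eval (n i)) * f i ω

theorem Sys.mono {p k Q : ℕ} {s s' : Finset ι} {n : ι → ℤ} {f : ι → Ω → ℂ} {w : Ω → ℝ}
    (h : Sys p k Q s n f w) (hs : s' ⊆ s) : Sys p k Q s' n f w :=
  ⟨h.nonneg, fun P hP => by
    obtain ⟨T, h1, h2⟩ := h.act P hP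
    exact ⟨T, h1, fun i hi ω => h2 i (hs hi) ω⟩⟩

theorem N2_nonneg {w : Ω → ℝ} (hw : ∀ ω, 0 ≤ w ω) (t : ℕ) (f : ι → Ω → ℂ) (s : Finset ι) :
    0 ≤ N2 w t f s := nt_nonneg hw t fun _ => by positivity

theorem N2_pow {w : Ω → ℝ} (hw : ∀ ω, 0 ≤ w ω) {t : ℕ} (ht : t ≠ 0) (f : ι → Ω → ℂ) (s : Finset ι) :
    N2 w t f s ^ t = ∑ ω, w ω * ‖F f s ω‖ ^ (2 * t) := by
  rw [N2, nt_pow hw ht fun _ => by positivity]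
  simp only [pow_mul]

theorem S_nonneg {w : Ω → ℝ} (hw : ∀ ω, 0 ≤ w ω) (t : ℕ) (f : ι → Ω → ℂ) (n : ι → ℤ) (s : Finset ι)
    (q : ℤ) : 0 ≤ S w t f n s q := Finset.sum_nonneg fun _ _ => N2_nonneg hw t f _

theorem mem_cl {n : ι → ℤ} {s : Finset ι} {q ξ : ℤ} {i : ι} :
    i ∈ cl n s q ξ ↔ i ∈ s ∧ n i % q = ξ % q := by simp [cl]

theorem cl_subset (n : ι → ℤ) (s : Finset ι) (q ξ : ℤ) : cl n s q ξ ⊆ s := Finset.filter_subset _ _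

theorem cl_congr (n : ι → ℤ) (s : Finset ι) {q ξ η : ℤ} (h : ξ % q = η % q) :
    cl n s q ξ = cl n s q η := by simp [cl, h]

theorem S_eq (w : Ω → ℝ) (t : ℕ) (f : ι → Ω → ℂ) (n : ι → ℤ) (s : Finset ι) (q : ℤ) :
    S w t f n s q = ∑ i ∈ s, N2 w t f (cl n s q (n i)) / (cl n s q (n i)).card := by
  unfold S
  refine Finset.sum_image' _ fun i hi => ?_
  have e1 : cl n s q (n i % q) = cl n s q (n i) := cl_congr n s (Int.emod_emod_of_dvd _ dvd_rfl)
  have e2 : ∑ j ∈ s with n j % q = n i % q, N2 w t f (cl n s q (n j)) / ((cl n s q (n j)).card : ℝ)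
      = ∑ j ∈ cl n s q (n i), N2 w t f (cl n s q (n i)) / ((cl n s q (n i)).card : ℝ) := by
    refine Finset.sum_congr rfl fun j hj => ?_
    rw [cl_congr n s (mem_cl.1 hj).2]
  rw [e1, e2, Finset.sum_const, nsmul_eq_mul, mul_div_cancel₀]
  have : 0 < (cl n s q (n i)).card := Finset.card_pos.2 ⟨i, mem_cl.2 ⟨hi, rfl⟩⟩
  exact_mod_cast this.ne'

theorem S_congr (w : Ω → ℝ) (t : ℕ) (f : ι → Ω → ℂ) (n n' : ι → ℤ) (s : Finset ι) (q q' : ℤ)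
    (h : ∀ i ∈ s, ∀ j ∈ s, n i % q = n j % q ↔ n' i % q' = n' j % q') :
    S w t f n s q = S w t f n' s q' := by
  rw [S_eq, S_eq]
  refine Finset.sum_congr rfl fun i hi => ?_
  have : cl n s q (n i) = cl n' s q' (n' i) := Finset.filter_congr fun j hj => h j hj i hi
  rw [this]

theorem emod_of_dvd {q0 q : ℤ} (h : q0 ∣ q) {x y : ℤ} (hxy : x % q = y % q) : x % q0 = y % q0 := by
  rw [← Int.emod_emod_of_dvd x h, hxy, Int.emod_emod_of_dvd y h]

theorem cl_cl (n : ι → ℤ) (s : Finset ι) {q0 q ξ c : ℤ} (h : q0 ∣ q) (hc : c % q0 = ξ % q0) :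
    cl n (cl n s q0 ξ) q c = cl n s q c := by
  ext j
  simp only [mem_cl]
  constructor
  · rintro ⟨⟨a, _⟩, b⟩; exact ⟨a, b⟩
  · rintro ⟨a, b⟩; exact ⟨⟨a, (emod_of_dvd h b).trans hc⟩, b⟩

theorem S_sub (w : Ω → ℝ) (t : ℕ) (f : ι → Ω → ℂ) (n : ι → ℤ) (s : Finset ι) {q0 q : ℤ}
    (h : q0 ∣ q) : ∑ c ∈ s.image (fun i => n i % q0), S w t f n (cl n s q0 c) q = S w t f n s q := by
  rw [S_eq w t f n s q, ← Finset.sum_fiberwise_of_maps_to (g := fun i => n i % q0)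
    (fun i hi => Finset.mem_image_of_mem _ hi)]
  refine Finset.sum_congr rfl fun c hc => ?_
  obtain ⟨i0, hi0, rfl⟩ := Finset.mem_image.1 hc
  have e1 : n i0 % q0 % q0 = n i0 % q0 := Int.emod_emod_of_dvd _ dvd_rfl
  rw [S_eq]
  have : cl n s q0 (n i0 % q0) = s.filter (fun i => n i % q0 = n i0 % q0) := by simp [cl]
  rw [this]
  refine Finset.sum_congr rfl fun i hi => ?_
  rw [← this, cl_cl n s h ((Finset.mem_filter.1 hi).2.trans e1.symm)]

theorem F_sub (f : ι → Ω → ℂ) (n : ι → ℤ) (s : Finset ι) (q : ℤ) (ω : Ω) :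
    F f s ω = ∑ c ∈ s.image (fun i => n i % q), F f (cl n s q c) ω := by
  unfold F
  rw [← Finset.sum_fiberwise_of_maps_to (g := fun i => n i % q)
    (fun i hi => Finset.mem_image_of_mem _ hi)]
  refine Finset.sum_congr rfl fun c hc => ?_
  obtain ⟨i0, hi0, rfl⟩ := Finset.mem_image.1 hc
  simp [cl]

def Dec (p k N : ℕ) (K : ℝ) : Prop :=
  ∀ (ι Ω : Type) [Fintype Ω] (s : Finset ι) (n : ι → ℤ) (f : ι → Ω → ℂ) (w : Ω → ℝ),
    Sys p k (k * N) s n f w → N2 w (tri k) f s ≤ K * S w (tri k) f n s ((p : ℤ) ^ N)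

def Bil (p k l a b N : ℕ) (M : ℝ) : Prop :=
  ∀ (ι Ω : Type) [Fintype Ω] (s : Finset ι) (n : ι → ℤ) (f : ι → Ω → ℂ) (w : Ω → ℝ),
    Sys p k (k * N) s n f w → ∀ ξ η : ℤ, ¬ (p : ℤ) ∣ ξ - η →
    ∑ ω, w ω * (‖F f (cl n s ((p : ℤ) ^ a) ξ) ω‖ ^ (2 * tri l) *
        ‖F f (cl n s ((p : ℤ) ^ b) η) ω‖ ^ (2 * (tri k - tri l))) ≤
      M * (S w (tri k) f n (cl n s ((p : ℤ) ^ a) ξ) ((p : ℤ) ^ N) ^ tri l *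
        S w (tri k) f n (cl n s ((p : ℤ) ^ b) η) ((p : ℤ) ^ N) ^ (tri k - tri l))

theorem Dec.mono {p k N : ℕ} {K K' : ℝ} (h : Dec p k N K) (hK : K ≤ K') : Dec p k N K' := by
  intro ι Ω _ s n f w hS
  exact (h ι Ω s n f w hS).trans (mul_le_mul_of_nonneg_right hK (S_nonneg hS.nonneg _ _ _ _ _))

theorem Bil.mono {p k l a b N : ℕ} {K K' : ℝ} (h : Bil p k l a b N K) (hK : K ≤ K') :
    Bil p k l a b N K' := by
  intro ι Ω _ s n f w hS ξ η hξ
  refine (h ι Ω s n f w hS ξ η hξ).trans (mul_le_mul_of_nonneg_right hK ?_)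
  exact mul_nonneg (pow_nonneg (S_nonneg hS.nonneg _ _ _ _ _) _) (pow_nonneg (S_nonneg hS.nonneg _ _ _ _ _) _)

theorem card_image_le (n : ι → ℤ) (s : Finset ι) {q : ℤ} (hq : 0 < q) :
    ((s.image (fun i => n i % q)).card : ℝ) ≤ q := by
  have : s.image (fun i => n i % q) ⊆ Finset.Ico 0 q := by
    intro c hc
    obtain ⟨i, _, rfl⟩ := Finset.mem_image.1 hc
    exact Finset.mem_Ico.2 ⟨Int.emod_nonneg _ hq.ne', Int.emod_lt_of_pos _ hq⟩
  have h2 := Finset.card_le_card this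
  rw [Int.card_Ico, sub_zero] at h2
  have h3 : ((s.image (fun i => n i % q)).card : ℤ) ≤ q := by omega
  exact_mod_cast h3

theorem Dec_trivial {p k : ℕ} (hp : 0 < p) (hk : 0 < k) (N : ℕ) : Dec p k N ((p : ℝ) ^ N) := by
  intro ι Ω _ s n f w hS
  have ht := (tri_pos hk).ne'
  set C := s.image (fun i => n i % (p : ℤ) ^ N) with hC
  have hcard : (C.card : ℝ) ≤ (p : ℝ) ^ N := by
    have := card_image_le n s (q := (p : ℤ) ^ N) (by positivity)
    push_cast at this; exact this
  have h1 : N2 w (tri k) f s ≤ nt w (tri k) (fun ω => (p : ℝ) ^ N * ∑ c ∈ C, ‖F f (cl n s ((p : ℤ) ^ N) c) ω‖ ^ 2) := by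
    refine nt_mono hS.nonneg ht (fun _ => by positivity) fun ω => ?_
    rw [F_sub f n s ((p : ℤ) ^ N)]
    calc _ ≤ (∑ c ∈ C, ‖F f (cl n s ((p : ℤ) ^ N) c) ω‖) ^ 2 := by
          gcongr; exact norm_sum_le _ _
      _ ≤ C.card * ∑ c ∈ C, ‖F f (cl n s ((p : ℤ) ^ N) c) ω‖ ^ 2 := sq_sum_le_card_mul_sum_sq
      _ ≤ _ := by gcongr
  refine h1.trans ((nt_smul hS.nonneg ht (fun ω => Finset.sum_nonneg fun _ _ => by positivity) (by positivity)).trans ?_)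
  refine mul_le_mul_of_nonneg_left ?_ (by positivity)
  exact nt_sum hS.nonneg ht C _ fun _ _ => by positivity

/-- one-dimensional case: orthogonality -/
theorem Dec_one {p : ℕ} (hp : 0 < p) (N : ℕ) : Dec p 1 N 1 := by
  intro ι Ω _ s n f w hS
  have t1 : tri 1 = 1 := rfl
  rw [t1, one_mul]
  set q := (p : ℤ) ^ N with hq
  set C := s.image (fun i => n i % q) with hC
  obtain ⟨T, hT1, hT2⟩ := hS.act X (by simp)
  have nsq : ∀ z : ℂ, ((‖z‖ ^ 2 : ℝ) : ℂ) = z * (starRingEnd ℂ) z := fun z => by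
    rw [Complex.mul_conj, Complex.normSq_eq_norm_sq]
  have N2eq : ∀ s' : Finset ι, N2 w 1 f s' = ∑ ω, w ω * ‖F f s' ω‖ ^ 2 := by
    intro s'; rw [N2, nt]; simp
  have hFT : ∀ c ∈ C, ∀ ω, F f (cl n s q c) (T ω) = e p N c * F f (cl n s q c) ω := by
    intro c hc ω
    unfold F
    rw [Finset.mul_sum]
    refine Finset.sum_congr rfl fun i hi => ?_
    rw [hT2 i (mem_cl.1 hi).1]
    congr 1
    simp only [one_mul, eval_X]
    refine e_congr hp.ne' ?_
    exact Int.ModEq.dvd (show c % q = n i % q from (mem_cl.1 hi).2.symm)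
  set Z : ℤ → ℤ → ℂ := fun c c' => ∑ ω, (w ω : ℂ) * (F f (cl n s q c) ω *
    (starRingEnd ℂ) (F f (cl n s q c') ω)) with hZ
  have hZ0 : ∀ c ∈ C, ∀ c' ∈ C, c ≠ c' → Z c c' = 0 := by
    intro c hc c' hc' hcc
    have h1 : Z c c' = (e p N c * (starRingEnd ℂ) (e p N c')) * Z c c' := by
      simp only [hZ]
      rw [Finset.mul_sum]
      rw [← Equiv.sum_comp T]
      refine Finset.sum_congr rfl fun ω _ => ?_
      rw [hT1, hFT c hc, hFT c' hc', map_mul]; ring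
    by_contra hne
    have h2 : e p N c * (starRingEnd ℂ) (e p N c') = 1 := by
      have := mul_right_cancel₀ hne (a := e p N c * (starRingEnd ℂ) (e p N c')) (b := Z c c') (c := 1)
        (by rw [one_mul]; exact h1.symm)
      exact this
    have h3 : e p N c' * (starRingEnd ℂ) (e p N c') = 1 := by
      rw [← nsq, norm_e]; simp
    have h4 : e p N (c - c') = 1 := by
      have h5 : e p N c = e p N (c - c') * e p N c' := by rw [← e_add]; congr 1; ring
      rw [h5, mul_assoc, h3, mul_one] at h2
      exact h2
    rw [e_eq_one_iff hp.ne', ← hq] at h4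
    have hq0 : 0 < q := by positivity
    apply hcc
    obtain ⟨i, _, rfl⟩ := Finset.mem_image.1 hc
    obtain ⟨j, _, rfl⟩ := Finset.mem_image.1 hc'
    have := Int.emod_eq_emod_iff_emod_sub_eq_zero.2 (Int.emod_eq_zero_of_dvd h4)
    simpa using this
  unfold S
  rw [t1] at *
  simp only [N2eq]
  have main : ((∑ ω, w ω * ‖F f s ω‖ ^ 2 : ℝ) : ℂ) =
      ((∑ c ∈ C, ∑ ω, w ω * ‖F f (cl n s q c) ω‖ ^ 2 : ℝ) : ℂ) := by
    push_cast
    have e1 : ∀ ω, (w ω : ℂ) * (‖F f s ω‖ : ℂ) ^ 2 = ∑ c ∈ C, ∑ c' ∈ C, (w ω : ℂ) * (F f (cl n s q c) ω *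
        (starRingEnd ℂ) (F f (cl n s q c') ω)) := by
      intro ω
      have := nsq (F f s ω)
      push_cast at this
      rw [this, F_sub f n s q ω, map_sum, Finset.sum_mul_sum, Finset.mul_sum]
      refine Finset.sum_congr rfl fun c _ => by rw [Finset.mul_sum]
    simp only [e1]
    rw [Finset.sum_comm]
    refine Finset.sum_congr rfl fun c hc => ?_
    rw [Finset.sum_comm, Finset.sum_eq_single c]
    · refine Finset.sum_congr rfl fun ω _ => ?_
      rw [← nsq]; push_cast; rfl
    · intro c' hc' hcc
      exact hZ0 c hc c' hc' hcc.symm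
    · intro h; exact absurd hc h
  exact le_of_eq (by exact_mod_cast main)
end VMV


namespace VMV
open Finset Polynomial

variable {ι Ω : Type} [Fintype Ω]

theorem emod_iff {q x y : ℤ} : x % q = y % q ↔ q ∣ x - y := by
  rw [Int.emod_eq_emod_iff_emod_sub_eq_zero, Int.dvd_iff_emod_eq_zero]

theorem rescale_poly (q : ℤ) (ξ : ℤ) (k : ℕ) (R : ℤ[X]) (hR : R.natDegree ≤ k) :
    ∃ P : ℤ[X], P.natDegree ≤ k ∧ ∀ m, P.eval (ξ + q * m) = q ^ k * R.eval m := by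
  refine ⟨∑ j ∈ range (k + 1), C (R.coeff j * q ^ (k - j)) * (X - C ξ) ^ j, ?_, ?_⟩
  · refine natDegree_sum_le_of_forall_le _ _ fun j hj => ?_
    refine (natDegree_C_mul_le _ _).trans ?_
    rw [natDegree_pow, natDegree_X_sub_C, mul_one]
    exact Nat.lt_succ_iff.1 (Finset.mem_range.1 hj)
  · intro m
    rw [eval_finset_sum, eval_eq_sum_range' (Nat.lt_succ_of_le hR), Finset.mul_sum]
    refine Finset.sum_congr rfl fun j hj => ?_
    have hj' := Nat.lt_succ_iff.1 (Finset.mem_range.1 hj)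
    simp only [eval_mul, eval_C, eval_pow, eval_sub, eval_X]
    have : q ^ k = q ^ (k - j) * q ^ j := by rw [← pow_add]; congr 1; omega
    rw [this]; ring

theorem Sys.rescale {p k N b : ℕ} (hp : p ≠ 0) {s I : Finset ι} {n m : ι → ℤ} {f : ι → Ω → ℂ}
    {w : Ω → ℝ} (h : Sys p k (k * N) s n f w) (hI : I ⊆ s) (hb : b ≤ N) (ξ : ℤ)
    (hm : ∀ i ∈ I, n i = ξ + (p : ℤ) ^ b * m i) : Sys p k (k * (N - b)) I m f w := by
  refine ⟨h.nonneg, fun R hR => ?_⟩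
  obtain ⟨P, hP, hP2⟩ := rescale_poly ((p : ℤ) ^ b) ξ k R hR
  obtain ⟨T, h1, h2⟩ := h.act P hP
  refine ⟨T, h1, fun i hi ω => ?_⟩
  rw [h2 i (hI hi), hm i hi, hP2, ← pow_mul, mul_comm b k, ← e_shift hp (k * (N - b)) (k * b),
    ← mul_add, Nat.sub_add_cancel hb]

theorem S_rescale {p N b : ℕ} (hp : p ≠ 0) (w : Ω → ℝ) (t : ℕ) {I : Finset ι} {n m : ι → ℤ}
    (f : ι → Ω → ℂ) (ξ : ℤ) 
    (hm : ∀ i ∈ I, n i = ξ + (p : ℤ) ^ b * m i) :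
    S w t f m I ((p : ℤ) ^ N) = S w t f n I ((p : ℤ) ^ (b + N)) := by
  refine S_congr _ _ _ _ _ _ _ _ fun i hi j hj => ?_
  rw [emod_iff, emod_iff, hm i hi, hm j hj, pow_add]
  have : ξ + (p : ℤ) ^ b * m i - (ξ + (p : ℤ) ^ b * m j) = (p : ℤ) ^ b * (m i - m j) := by ring
  rw [this]
  exact (mul_dvd_mul_iff_left (pow_ne_zero _ (by exact_mod_cast hp))).symm

theorem cl_param {n : ι → ℤ} {s : Finset ι} {q ξ : ℤ} :
    ∀ i ∈ cl n s q ξ, n i = ξ + q * ((n i - ξ) / q) := by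
  intro i hi
  have := emod_iff.1 (mem_cl.1 hi).2
  rw [Int.mul_ediv_cancel' this]; ring

theorem Dec.cls {p k N b : ℕ} (hp : p ≠ 0) {K : ℝ} (h : Dec p k (N - b) K) (hb : b ≤ N)
    {s : Finset ι} {n : ι → ℤ} {f : ι → Ω → ℂ}
    {w : Ω → ℝ} (hS : Sys p k (k * N) s n f w) (ξ : ℤ) :
    N2 w (tri k) f (cl n s ((p : ℤ) ^ b) ξ) ≤
      K * S w (tri k) f n (cl n s ((p : ℤ) ^ b) ξ) ((p : ℤ) ^ N) := by
  have := h ι Ω _ _ _ _ (hS.rescale hp (cl_subset n s _ ξ) hb ξ cl_param)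
  rw [S_rescale hp w _ f ξ cl_param, Nat.add_sub_cancel' hb] at this
  exact this

theorem poly_core {A : Type} [CommRing A] (k l : ℕ) (hlk : l ≤ k)
    (hu : ∀ i : ℕ, 1 ≤ i → i ≤ k → IsUnit (i : A)) (δ : A) (hδ : IsUnit δ) (V : A[X]) :
    ∃ P : A[X], P.natDegree ≤ k ∧ X ^ (k - l + 1) ∣ P ∧ ∃ c : A,
      (X - C δ) ^ (l + 1) ∣ P - V - C c := by
  nontriviality A
  have hcop : IsCoprime (X ^ (k - l) : A[X]) ((X - C δ) ^ l) := by
    apply IsCoprime.pow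
    obtain ⟨d, hd⟩ := hδ
    refine ⟨C (↑d⁻¹ : A), -C (↑d⁻¹ : A), ?_⟩
    rw [← hd]
    have : (C (↑d⁻¹ : A) * C (d : A) : A[X]) = 1 := by rw [← C_mul]; simp
    linear_combination this
  obtain ⟨u, v, huv⟩ := hcop
  have hmon : ((X - C δ) ^ l : A[X]).Monic := (monic_X_sub_C δ).pow l
  set W := (u * derivative V) %ₘ ((X - C δ) ^ l) with hW
  have hWdvd : (X - C δ) ^ l ∣ X ^ (k - l) * W - derivative V := by
    have h1 := modByMonic_add_div (u * derivative V) ((X - C δ) ^ l)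
    refine ⟨-(v * derivative V) - X ^ (k - l) * (u * derivative V /ₘ (X - C δ) ^ l), ?_⟩
    rw [hW]
    linear_combination (X ^ (k - l)) * h1 + derivative V * huv
  have hWdeg : W.degree < l := by
    have := degree_modByMonic_lt (u * derivative V) hmon
    rwa [degree_pow' (by simp), degree_X_sub_C, nsmul_one] at this
  set D := X ^ (k - l) * W with hD
  have hDdeg : ∀ i, k ≤ i → D.coeff i = 0 := by
    intro i hi
    rw [hD, coeff_X_pow_mul', if_pos (by omega)]
    apply coeff_eq_zero_of_degree_lt
    exact hWdeg.trans_le (by exact_mod_cast (by omega : l ≤ i - (k - l)))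
  have hDlow : ∀ i, i < k - l → D.coeff i = 0 := by
    intro i hi
    rw [hD, coeff_X_pow_mul', if_neg (by omega)]
  choose! inv hinv using fun (i : ℕ) (h : 1 ≤ i ∧ i ≤ k) => (hu i h.1 h.2).exists_right_inv
  set P : A[X] := ∑ i ∈ range k, monomial (i + 1) (inv (i + 1) * D.coeff i) with hP
  have hPc : ∀ i, P.coeff i = if 1 ≤ i ∧ i ≤ k then inv i * D.coeff (i - 1) else 0 := by
    intro i
    rw [hP, finsetSum_coeff]
    simp only [coeff_monomial]
    split_ifs with h
    · rw [Finset.sum_eq_single (i - 1)]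
      · rw [if_pos (by omega), Nat.sub_add_cancel h.1]
      · intro j _ hj; rw [if_neg (by omega)]
      · intro hj; rw [Finset.mem_range] at hj; omega
    · refine Finset.sum_eq_zero fun j hj => ?_
      rw [Finset.mem_range] at hj
      rw [if_neg (by omega)]
  have hder : derivative P = D := by
    ext i
    rw [coeff_derivative, hPc]
    split_ifs with h
    · have := hinv (i + 1) h
      push_cast at this
      rw [Nat.add_sub_cancel]
      linear_combination D.coeff i * this
    · rw [hDdeg i (by omega), zero_mul]
  refine ⟨P, ?_, ?_, ?_⟩
  · rw [natDegree_le_iff_coeff_eq_zero]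
    intro i hi
    rw [hPc, if_neg (by omega)]
  · rw [X_pow_dvd_iff]
    intro i hi
    rw [hPc]
    split_ifs with h
    · rw [hDlow _ (by omega), mul_zero]
    · rfl
  · set G := taylor δ (P - V) with hG
    refine ⟨G.coeff 0, ?_⟩
    have hdG : X ^ l ∣ derivative G := by
      have h1 : derivative G = taylor δ (derivative (P - V)) := by
        rw [hG, taylor_apply, taylor_apply, derivative_comp]; simp
      rw [h1, derivative_sub, hder]
      obtain ⟨Y, hY⟩ := hWdvd
      rw [hY, taylor_apply, mul_comp, pow_comp]
      simp
    rw [X_pow_dvd_iff] at hdG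
    have hGX : X ^ (l + 1) ∣ G - C (G.coeff 0) := by
      rw [X_pow_dvd_iff]
      intro i hi
      rcases i with _ | i
      · simp
      · have h1 := hdG i (by omega)
        rw [coeff_derivative] at h1
        rw [coeff_sub, coeff_C, if_neg (by omega), sub_zero]
        have h2 := hinv (i + 1) (by omega)
        push_cast at h2
        linear_combination inv (i + 1) * h1 - G.coeff (i + 1) * h2
    obtain ⟨Y, hY⟩ := hGX
    refine ⟨taylor (-δ) Y, ?_⟩
    have e0 : taylor (-δ) G = P - V := by rw [hG, taylor_taylor]; simp
    have e1 : P - V - C (G.coeff 0) = taylor (-δ) (G - C (G.coeff 0)) := by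
      rw [map_sub, taylor_C, e0]
    have e2 : taylor (-δ) (X ^ (l + 1)) = (X - C δ) ^ (l + 1) := by
      rw [taylor_apply, pow_comp, X_comp]; simp [sub_eq_add_neg]
    rw [e1, hY, taylor_mul, e2]

theorem exists_lift {q : ℕ} (P : (ZMod q)[X]) (k : ℕ) (hP : P.natDegree ≤ k) :
    ∃ P' : ℤ[X], P'.natDegree ≤ k ∧ P'.map (Int.castRingHom (ZMod q)) = P := by
  choose g hg using ZMod.intCast_surjective (n := q)
  refine ⟨∑ i ∈ range (k + 1), monomial i (g (P.coeff i)), ?_, ?_⟩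
  · refine natDegree_sum_le_of_forall_le _ _ fun j hj => ?_
    exact (natDegree_monomial_le _).trans (Nat.lt_succ_iff.1 (Finset.mem_range.1 hj))
  · rw [Polynomial.map_sum]
    conv_rhs => rw [P.as_sum_range' (k + 1) (Nat.lt_succ_of_le hP)]
    refine Finset.sum_congr rfl fun i _ => ?_
    rw [map_monomial]; simp [hg]

theorem poly_lemma {p : ℕ} (hp : p.Prime) {k l : ℕ} (hkp : k < p) (hlk : l ≤ k)
    {ξ η : ℤ} (hξ : ¬ (p : ℤ) ∣ ξ - η) {a b B : ℕ} (hB1 : B ≤ (k - l + 1) * b) (hB2 : B ≤ (l + 1) * a)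
    (R : ℤ[X]) (hR : R.natDegree ≤ l) :
    ∃ P : ℤ[X], P.natDegree ≤ k ∧ ∃ c : ℤ, (∀ n, (p : ℤ) ^ b ∣ n - η → (p : ℤ) ^ B ∣ P.eval n - c) ∧
      ∀ m, (p : ℤ) ^ B ∣ P.eval (ξ + (p : ℤ) ^ a * m) - (p : ℤ) ^ (l * a) * R.eval m := by
  have hunit : ∀ x : ℤ, ¬ (p : ℤ) ∣ x → IsUnit (x : ZMod (p ^ B)) := by
    intro x hx
    rw [ZMod.coe_int_isUnit_iff_isCoprime]
    push_cast
    apply IsCoprime.pow_left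
    exact (Nat.prime_iff_prime_int.1 hp).coprime_iff_not_dvd.2 hx
  obtain ⟨V, hV, hV2⟩ := rescale_poly ((p : ℤ) ^ a) (ξ - η) l R hR
  set φ := Int.castRingHom (ZMod (p ^ B)) with hφ
  obtain ⟨P, hP1, hP2, c, hP3⟩ := poly_core (A := ZMod (p ^ B)) k l hlk (fun i h1 h2 => by
    have := hunit i (by
      intro h
      have h3 := Nat.le_of_dvd h1 (Int.natCast_dvd_natCast.1 h)
      omega)
    simpa using this) ((ξ - η : ℤ) : ZMod (p ^ B)) (hunit _ hξ) (V.map φ)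
  obtain ⟨P', hP'1, hP'2⟩ := exists_lift P k hP1
  obtain ⟨c', rfl⟩ := ZMod.intCast_surjective c
  have hdvd : ∀ x : ℤ, (p : ℤ) ^ B ∣ x ↔ (x : ZMod (p ^ B)) = 0 := by
    intro x
    rw [ZMod.intCast_zmod_eq_zero_iff_dvd]; push_cast; rfl
  have hev : ∀ (Q : ℤ[X]) (x : ℤ), ((Q.eval x : ℤ) : ZMod (p ^ B)) = (Q.map φ).eval (x : ZMod (p ^ B)) := by
    intro Q x
    rw [← eq_intCast φ, ← eq_intCast φ, eval_map_apply]
  refine ⟨P'.comp (X - C η) - C c', ?_, -c', ?_, ?_⟩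
  · rw [natDegree_sub_C, natDegree_comp, natDegree_X_sub_C, mul_one]; exact hP'1
  · intro n hn
    rw [hdvd]
    simp only [eval_sub, eval_comp, eval_X, eval_C]
    rw [sub_neg_eq_add, sub_add_cancel, hev, hP'2]
    obtain ⟨Y, hY⟩ := hP2
    obtain ⟨z, hz⟩ := hn
    rw [hY, eval_mul, eval_pow, eval_X, ← Int.cast_pow, hz]
    have : (((((p : ℤ) ^ b * z) ^ (k - l + 1) : ℤ)) : ZMod (p ^ B)) = 0 := by
      rw [← hdvd, mul_pow, ← pow_mul, mul_comm b]
      exact Dvd.dvd.mul_right (pow_dvd_pow _ hB1) _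
    rw [this, zero_mul]
  · intro m
    rw [hdvd]
    obtain ⟨Y, hY⟩ := hP3
    have h1 := congrArg (Polynomial.eval (((ξ - η + (p : ℤ) ^ a * m : ℤ)) : ZMod (p ^ B))) hY
    have e1 : (p : ℤ) ^ (l * a) * R.eval m = V.eval (ξ - η + (p : ℤ) ^ a * m) := by
      rw [hV2, ← pow_mul, mul_comm a l]
    rw [e1]
    simp only [eval_sub, eval_comp, eval_X, eval_C]
    have e2 : ξ + (p : ℤ) ^ a * m - η = ξ - η + (p : ℤ) ^ a * m := by ring
    rw [e2, Int.cast_sub, Int.cast_sub, hev, hev, hP'2]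
    simp only [eval_sub, eval_C, eval_mul, eval_pow, eval_X] at h1
    have e3 : (((ξ - η + (p : ℤ) ^ a * m : ℤ) : ZMod (p ^ B)) - ((ξ - η : ℤ) : ZMod (p ^ B))) ^ (l + 1) = 0 := by
      rw [← Int.cast_sub, ← Int.cast_pow, ← hdvd, add_sub_cancel_left, mul_pow, ← pow_mul, mul_comm a]
      exact Dvd.dvd.mul_right (pow_dvd_pow _ hB2) _
    rw [e3, zero_mul] at h1
    linear_combination h1
end VMV


namespace VMV
open Finset Polynomial

variable {ι Ω : Type} [Fintype Ω]

theorem Sys.lower {p : ℕ} (hp : p.Prime) {k l N a b N' : ℕ} (hkp : k < p) (hlk : l ≤ k)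
    {ξ η : ℤ} (hξ : ¬ (p : ℤ) ∣ ξ - η) (h1 : l * (a + N') ≤ (k - l + 1) * b) (h2 : l * N' ≤ a)
    (h3 : a + N' ≤ N) {s : Finset ι} {n m : ι → ℤ} {f : ι → Ω → ℂ}
    {w : Ω → ℝ} (h : Sys p k (k * N) s n f w) (r : ℕ)
    (hm : ∀ i ∈ cl n s ((p : ℤ) ^ a) ξ, n i = ξ + (p : ℤ) ^ a * m i) :
    Sys p l (l * N') (cl n s ((p : ℤ) ^ a) ξ) m f
      (fun ω => w ω * ‖F f (cl n s ((p : ℤ) ^ b) η) ω‖ ^ r) := by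
  refine ⟨fun ω => mul_nonneg (h.nonneg ω) (by positivity), fun R hR => ?_⟩
  have hB2 : l * (a + N') ≤ (l + 1) * a := by nlinarith
  obtain ⟨P, hP, c, hP1, hP2⟩ := poly_lemma hp hkp hlk hξ h1 hB2 R hR
  have hBN : l * (a + N') ≤ k * N := Nat.mul_le_mul hlk h3
  obtain ⟨d, hd⟩ := Nat.exists_eq_add_of_le hBN
  obtain ⟨T, hT1, hT2⟩ := h.act (C ((p : ℤ) ^ d) * P) ((natDegree_C_mul_le _ _).trans hP)
  have hFT : ∀ ω, ‖F f (cl n s ((p : ℤ) ^ b) η) (T ω)‖ = ‖F f (cl n s ((p : ℤ) ^ b) η) ω‖ := by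
    intro ω
    have : F f (cl n s ((p : ℤ) ^ b) η) (T ω) =
        e p (k * N) ((p : ℤ) ^ d * c) * F f (cl n s ((p : ℤ) ^ b) η) ω := by
      unfold F
      rw [Finset.mul_sum]
      refine Finset.sum_congr rfl fun i hi => ?_
      rw [hT2 i (mem_cl.1 hi).1]
      congr 1
      apply e_congr hp.ne_zero
      rw [eval_mul, eval_C, ← mul_sub, hd, pow_add, mul_comm]
      exact mul_dvd_mul_left _ (hP1 _ (emod_iff.1 (mem_cl.1 hi).2))
    rw [this, norm_mul, norm_e, one_mul]
  refine ⟨T, fun ω => by rw [hT1, hFT], fun i hi ω => ?_⟩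
  rw [hT2 i (mem_cl.1 hi).1]
  congr 1
  rw [← e_shift hp.ne_zero (l * N') (l * a + d)]
  have e1 : l * N' + (l * a + d) = k * N := by rw [hd]; ring
  rw [e1]
  apply e_congr hp.ne_zero
  rw [hm i hi, eval_mul, eval_C]
  have e2 : (p : ℤ) ^ d * P.eval (ξ + (p : ℤ) ^ a * m i) - (p : ℤ) ^ (l * a + d) * R.eval (m i)
      = (p : ℤ) ^ d * (P.eval (ξ + (p : ℤ) ^ a * m i) - (p : ℤ) ^ (l * a) * R.eval (m i)) := by
    rw [pow_add]; ring
  rw [e2, hd, pow_add, mul_comm]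
  exact mul_dvd_mul_left _ (hP2 _)

theorem Bil.lower {p : ℕ} (hp : p.Prime) {k l N a b N' : ℕ} (hkp : k < p) (hl : 0 < l) (hlk : l < k)
    (ha : 0 < a) (h1 : l * (a + N') ≤ (k - l + 1) * b) (h2 : l * N' ≤ a)
    (h3 : a + N' ≤ N) {K M : ℝ} (hK : 0 ≤ K) (hM : 0 ≤ M) (hD : Dec p l N' K)
    (hB : Bil p k l (a + N') b N M) : Bil p k l a b N (K ^ tri l * M) := by
  intro ι Ω _ s n f w hS ξ η hξ
  have hl0 := (tri_pos hl).ne'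
  set I := cl n s ((p : ℤ) ^ a) ξ with hI
  set S' := S w (tri k) f n (cl n s ((p : ℤ) ^ b) η) ((p : ℤ) ^ N) ^ (tri k - tri l) with hS'
  have hS'0 : 0 ≤ S' := pow_nonneg (S_nonneg hS.nonneg _ _ _ _ _) _
  set w' : Ω → ℝ := fun ω => w ω * ‖F f (cl n s ((p : ℤ) ^ b) η) ω‖ ^ (2 * (tri k - tri l)) with hw'
  have hsys := Sys.lower hp hkp hlk.le hξ h1 h2 h3 hS (2 * (tri k - tri l)) (m := fun i => (n i - ξ) / (p : ℤ) ^ a)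
    cl_param
  have hdec := hD _ _ _ _ _ _ hsys
  rw [S_rescale hp.ne_zero _ _ f ξ cl_param] at hdec
  have hw'0 : ∀ ω, 0 ≤ w' ω := hsys.nonneg
  set D := (M * S') ^ (1 / (tri l : ℝ)) with hDd
  have hD0 : 0 ≤ D := by positivity
  have hDp : D ^ tri l = M * S' := by
    rw [hDd, one_div, Real.rpow_inv_natCast_pow (by positivity) hl0]
  have hsum : S w' (tri l) f n I ((p : ℤ) ^ (a + N')) ≤ D * S w (tri k) f n I ((p : ℤ) ^ N) := by
    rw [← S_sub w (tri k) f n I (pow_dvd_pow (p : ℤ) h3), Finset.mul_sum]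
    refine Finset.sum_le_sum fun c hc => ?_
    obtain ⟨i, hi, rfl⟩ := Finset.mem_image.1 hc
    have hci : (n i % (p : ℤ) ^ (a + N')) % (p : ℤ) ^ a = ξ % (p : ℤ) ^ a := by
      rw [Int.emod_emod_of_dvd _ (pow_dvd_pow _ (Nat.le_add_right a N'))]
      exact (mem_cl.1 hi).2
    set c := n i % (p : ℤ) ^ (a + N') with hcd
    rw [hI, cl_cl n s (pow_dvd_pow _ (Nat.le_add_right a N')) hci]
    have hcη : ¬ (p : ℤ) ∣ c - η := by
      intro hh
      apply hξ
      have h5 : (p : ℤ) ∣ c - ξ := (dvd_pow_self _ ha.ne').trans (emod_iff.1 hci)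
      have := dvd_sub hh h5
      simpa using this
    refine le_of_pow_le_pow_left₀ hl0 (mul_nonneg hD0 (S_nonneg hS.nonneg _ _ _ _ _)) ?_
    rw [N2_pow hw'0 hl0, mul_pow, hDp]
    have := hB ι Ω s n f w hS c η hcη
    calc _ = ∑ ω, w ω * (‖F f (cl n s ((p : ℤ) ^ (a + N')) c) ω‖ ^ (2 * tri l) *
        ‖F f (cl n s ((p : ℤ) ^ b) η) ω‖ ^ (2 * (tri k - tri l))) :=
          Finset.sum_congr rfl fun ω _ => by rw [hw']; ring
      _ ≤ _ := this
      _ = _ := by rw [hS']; ring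
  have hfin : N2 w' (tri l) f I ≤ K * (D * S w (tri k) f n I ((p : ℤ) ^ N)) :=
    hdec.trans (mul_le_mul_of_nonneg_left hsum hK)
  have := pow_le_pow_left₀ (N2_nonneg hw'0 _ _ _) hfin (tri l)
  rw [N2_pow hw'0 hl0, mul_pow, mul_pow, hDp] at this
  calc _ = ∑ ω, w' ω * ‖F f I ω‖ ^ (2 * tri l) :=
        Finset.sum_congr rfl fun ω _ => by rw [hw']; ring
    _ ≤ _ := this
    _ = _ := by ring

theorem tri_id (l0 d : ℕ) :
    tri (l0 + 1) * (1 + d) = (tri (l0 + 1 + d) - tri d) + d * tri l0 ∧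
    (tri (l0 + 1 + d) - tri (l0 + 1)) * (1 + d) = tri d + d * (tri (l0 + 1 + d) - tri l0) := by
  have a1 := two_tri (l0 + 1)
  have a2 := two_tri (l0 + 1 + d)
  have a3 := two_tri d
  have a4 := two_tri l0
  have b1 : tri d ≤ tri (l0 + 1 + d) := by nlinarith
  have b2 : tri (l0 + 1) ≤ tri (l0 + 1 + d) := by nlinarith
  have b3 : tri l0 ≤ tri (l0 + 1 + d) := by nlinarith
  zify [b1, b2, b3] at *
  constructor
  · apply mul_left_cancel₀ (two_ne_zero (α := ℤ))
    linear_combination (1 + d : ℤ) * a1 - a2 + a3 - d * a4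
  · apply mul_left_cancel₀ (two_ne_zero (α := ℤ))
    linear_combination (1 : ℤ) * a2 - (1 + d) * a1 - a3 + d * a4

theorem Bil.holder {p k l a b N : ℕ} (hl : 0 < l) (hlk : l < k) {M1 M2 M : ℝ}
    (h1 : Bil p k (k - l) b a N M1) (h2 : Bil p k (l - 1) a b N M2) (hM1 : 0 ≤ M1) (hM2 : 0 ≤ M2)
    (hM0 : 0 ≤ M) (hM : M1 * M2 ^ (k - l) ≤ M ^ (1 + (k - l))) : Bil p k l a b N M := by
  intro ι Ω _ s n f w hS ξ η hξ
  obtain ⟨l0, rfl⟩ : ∃ l0, l = l0 + 1 := ⟨l - 1, by omega⟩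
  obtain ⟨d, rfl⟩ := Nat.exists_eq_add_of_lt hlk
  have e1 : l0 + 1 + d + 1 - (l0 + 1) = d + 1 := by omega
  have e2 : l0 + 1 + d + 1 = l0 + 1 + (d + 1) := by ring
  have e3 : l0 + 1 - 1 = l0 := by omega
  rw [e1] at hM h1
  rw [e2] at *
  rw [e3] at h2
  have i1 := h1 ι Ω s n f w hS η ξ (fun h => hξ (by rw [← neg_sub]; exact (dvd_neg).2 h))
  have i2 := h2 ι Ω s n f w hS ξ η hξ
  obtain ⟨t1, t2⟩ := tri_id l0 (d + 1)
  set U := S w (tri (l0 + 1 + (d + 1))) f n (cl n s ((p : ℤ) ^ a) ξ) ((p : ℤ) ^ N)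
  set V := S w (tri (l0 + 1 + (d + 1))) f n (cl n s ((p : ℤ) ^ b) η) ((p : ℤ) ^ N)
  have hU : 0 ≤ U := S_nonneg hS.nonneg _ _ _ _ _
  have hV : 0 ≤ V := S_nonneg hS.nonneg _ _ _ _ _
  have comb : ∀ x y : ℝ, (x ^ (tri (l0 + 1)) * y ^ (tri (l0 + 1 + (d + 1)) - tri (l0 + 1))) ^ (1 + (d + 1)) =
      (y ^ tri (d + 1) * x ^ (tri (l0 + 1 + (d + 1)) - tri (d + 1))) ^ 1 *
      (x ^ tri l0 * y ^ (tri (l0 + 1 + (d + 1)) - tri l0)) ^ (d + 1) := by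
    intro x y
    rw [mul_pow, ← pow_mul, ← pow_mul, t1, t2, pow_add, pow_add, pow_one, mul_pow, ← pow_mul, ← pow_mul,
      mul_comm (d + 1), mul_comm (d + 1)]
    ring
  have H := holder_nat w
    (fun ω => ‖F f (cl n s ((p : ℤ) ^ a) ξ) ω‖ ^ (2 * tri (l0 + 1)) *
        ‖F f (cl n s ((p : ℤ) ^ b) η) ω‖ ^ (2 * (tri (l0 + 1 + (d + 1)) - tri (l0 + 1))))
    (fun ω => ‖F f (cl n s ((p : ℤ) ^ b) η) ω‖ ^ (2 * tri (d + 1)) *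
        ‖F f (cl n s ((p : ℤ) ^ a) ξ) ω‖ ^ (2 * (tri (l0 + 1 + (d + 1)) - tri (d + 1))))
    (fun ω => ‖F f (cl n s ((p : ℤ) ^ a) ξ) ω‖ ^ (2 * tri l0) *
        ‖F f (cl n s ((p : ℤ) ^ b) η) ω‖ ^ (2 * (tri (l0 + 1 + (d + 1)) - tri l0)))
    hS.nonneg (fun ω => by positivity) (fun ω => by positivity) (fun ω => by positivity) 1 (d + 1)
    one_pos (by omega) (fun ω => le_of_eq (by simp only [pow_mul]; exact comb _ _))
  refine le_of_pow_le_pow_left₀ (n := 1 + (d + 1)) (by omega) (by positivity) ?_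
  refine H.trans ?_
  have nn : ∀ X : Ω → ℝ, (∀ ω, 0 ≤ X ω) → 0 ≤ ∑ ω, w ω * X ω := fun X hX =>
    Finset.sum_nonneg fun ω _ => mul_nonneg (hS.nonneg ω) (hX ω)
  calc _ ≤ (M1 * (V ^ tri (d + 1) * U ^ (tri (l0 + 1 + (d + 1)) - tri (d + 1)))) ^ 1 *
      (M2 * (U ^ tri l0 * V ^ (tri (l0 + 1 + (d + 1)) - tri l0))) ^ (d + 1) := by
        refine mul_le_mul (pow_le_pow_left₀ (nn _ fun ω => by positivity) i1 _)
          (pow_le_pow_left₀ (nn _ fun ω => by positivity) i2 _)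
          (pow_nonneg (nn _ fun ω => by positivity) _) (by positivity)
    _ = (M1 * M2 ^ (d + 1)) * (U ^ (tri (l0 + 1)) * V ^ (tri (l0 + 1 + (d + 1)) - tri (l0 + 1))) ^ (1 + (d + 1)) := by
        rw [comb, mul_pow, mul_pow M2]; ring
    _ ≤ _ := by
        rw [mul_pow M]
        exact mul_le_mul_of_nonneg_right hM (by positivity)

theorem Bil_trivial {p k l a b N : ℕ} (hp : p ≠ 0) (hl : 0 < l) (hlk : l < k) (ha : a ≤ N) (hb : b ≤ N)
    {K1 K2 : ℝ} (hK1 : 0 ≤ K1) (hK2 : 0 ≤ K2) (h1 : Dec p k (N - a) K1) (h2 : Dec p k (N - b) K2) :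
    Bil p k l a b N (K1 ^ tri l * K2 ^ (tri k - tri l)) := by
  intro ι Ω _ s n f w hS ξ η hξ
  have i1 := h1.cls hp ha hS ξ
  have i2 := h2.cls hp hb hS η
  have hlt := tri_lt hlk
  have hl0 := tri_pos hl
  have hadd : tri l + (tri k - tri l) = tri k := by omega
  have hk0 : tri k ≠ 0 := by omega
  set U := S w (tri k) f n (cl n s ((p : ℤ) ^ a) ξ) ((p : ℤ) ^ N)
  set V := S w (tri k) f n (cl n s ((p : ℤ) ^ b) η) ((p : ℤ) ^ N)
  have hU : 0 ≤ U := S_nonneg hS.nonneg _ _ _ _ _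
  have hV : 0 ≤ V := S_nonneg hS.nonneg _ _ _ _ _
  have H := holder_nat w
    (fun ω => ‖F f (cl n s ((p : ℤ) ^ a) ξ) ω‖ ^ (2 * tri l) *
        ‖F f (cl n s ((p : ℤ) ^ b) η) ω‖ ^ (2 * (tri k - tri l)))
    (fun ω => ‖F f (cl n s ((p : ℤ) ^ a) ξ) ω‖ ^ (2 * tri k))
    (fun ω => ‖F f (cl n s ((p : ℤ) ^ b) η) ω‖ ^ (2 * tri k))
    hS.nonneg (fun ω => by positivity) (fun ω => by positivity) (fun ω => by positivity)
    (tri l) (tri k - tri l) hl0 (by omega) (fun ω => le_of_eq (by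
      rw [hadd, mul_pow, ← pow_mul, ← pow_mul, ← pow_mul, ← pow_mul]; congr 2 <;> ring))
  rw [hadd] at H
  refine le_of_pow_le_pow_left₀ hk0 (by positivity) (H.trans ?_)
  rw [← N2_pow hS.nonneg hk0, ← N2_pow hS.nonneg hk0]
  have j1 := pow_le_pow_left₀ (N2_nonneg hS.nonneg (tri k) f _) i1 (tri k * tri l)
  have j2 := pow_le_pow_left₀ (N2_nonneg hS.nonneg (tri k) f _) i2 (tri k * (tri k - tri l))
  rw [← pow_mul, ← pow_mul]
  refine (mul_le_mul j1 j2 (pow_nonneg (N2_nonneg hS.nonneg _ _ _) _) (by positivity)).trans (le_of_eq ?_)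
  rw [mul_comm (tri k) (tri l), mul_comm (tri k) (tri k - tri l), pow_mul, pow_mul, ← mul_pow]
  congr 1
  ring

theorem Bil_zero {p k a b N : ℕ} (hp : p ≠ 0) (hk : 0 < k) (hb : b ≤ N)
    {K : ℝ} (h2 : Dec p k (N - b) K) :
    Bil p k 0 a b N (K ^ tri k) := by
  intro ι Ω _ s n f w hS ξ η hξ
  have i2 := h2.cls hp hb hS η
  have t0 : tri 0 = 0 := rfl
  have := pow_le_pow_left₀ (N2_nonneg hS.nonneg (tri k) f _) i2 (tri k)
  rw [N2_pow hS.nonneg (tri_pos hk).ne', mul_pow] at this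
  simpa [t0] using this

end VMV


namespace VMV
open Finset Polynomial

variable {ι Ω : Type} [Fintype Ω]

theorem S_cl_le {w : Ω → ℝ} (hw : ∀ ω, 0 ≤ w ω) (t : ℕ) (f : ι → Ω → ℂ) (n : ι → ℤ) (s : Finset ι)
    {q0 q c : ℤ} (h : q0 ∣ q) (hc : c ∈ s.image (fun i => n i % q0)) :
    S w t f n (cl n s q0 c) q ≤ S w t f n s q := by
  rw [← S_sub w t f n s h]
  exact Finset.single_le_sum (f := fun c => S w t f n (cl n s q0 c) q)
    (fun c _ => S_nonneg hw _ _ _ _ _) hc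

theorem pair_bound {p k l a N : ℕ} {M : ℝ} (hl : 0 < l) (hlk : l < k)
    (hM : 0 ≤ M) (haN : a ≤ N) (hB : Bil p k l a a N M)
    {s : Finset ι} {n : ι → ℤ} {f : ι → Ω → ℂ} {w : Ω → ℝ} (hS : Sys p k (k * N) s n f w)
    {c c' : ℤ} (hc : c ∈ s.image (fun i => n i % (p : ℤ) ^ a))
    (hc' : c' ∈ s.image (fun i => n i % (p : ℤ) ^ a)) (hcc : ¬ (p : ℤ) ∣ c - c') :
    nt w (tri k) (fun ω => ‖F f (cl n s ((p : ℤ) ^ a) c) ω‖ * ‖F f (cl n s ((p : ℤ) ^ a) c') ω‖) ≤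
      M ^ (1 / (tri k : ℝ)) * S w (tri k) f n s ((p : ℤ) ^ N) := by
  have hlt := tri_lt hlk
  have htl := tri_pos hl
  have ht : tri k ≠ 0 := by omega
  set A := cl n s ((p : ℤ) ^ a) c
  set B := cl n s ((p : ℤ) ^ a) c'
  set q := (p : ℤ) ^ N with hq
  have hd : (p : ℤ) ^ a ∣ q := pow_dvd_pow _ haN
  set t := tri k
  set u := tri l
  set Z := S w t f n s q
  have hZ : 0 ≤ Z := S_nonneg hS.nonneg _ _ _ _ _
  have hA0 : 0 ≤ S w t f n A q := S_nonneg hS.nonneg _ _ _ _ _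
  have hB0 : 0 ≤ S w t f n B q := S_nonneg hS.nonneg _ _ _ _ _
  have hA : S w t f n A q ≤ Z := S_cl_le hS.nonneg t f n s hd hc
  have hB' : S w t f n B q ≤ Z := S_cl_le hS.nonneg t f n s hd hc'
  have hsplit : Z ^ u * Z ^ (t - u) = Z ^ t := by rw [← pow_add]; congr 1; omega
  have b1 : ∑ ω, w ω * (‖F f A ω‖ ^ (2 * u) * ‖F f B ω‖ ^ (2 * (t - u))) ≤ M * Z ^ t := by
    refine (hB ι Ω s n f w hS c c' hcc).trans ?_
    rw [← hsplit]
    gcongr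
  have b2 : ∑ ω, w ω * (‖F f B ω‖ ^ (2 * u) * ‖F f A ω‖ ^ (2 * (t - u))) ≤ M * Z ^ t := by
    refine (hB ι Ω s n f w hS c' c (fun h => hcc ?_)).trans ?_
    · rw [← Int.dvd_neg, neg_sub]; exact h
    rw [← hsplit]
    gcongr
  have b3 := holder_nat w (fun ω => ‖F f A ω‖ ^ t * ‖F f B ω‖ ^ t)
    (fun ω => ‖F f A ω‖ ^ (2 * u) * ‖F f B ω‖ ^ (2 * (t - u)))
    (fun ω => ‖F f B ω‖ ^ (2 * u) * ‖F f A ω‖ ^ (2 * (t - u))) hS.nonneg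
    (fun _ => by positivity) (fun _ => by positivity) (fun _ => by positivity) 1 1 one_pos one_pos
    (fun ω => by
      have e1 : 2 * u + 2 * (t - u) = 2 * t := by omega
      apply le_of_eq
      rw [pow_one, pow_one]
      calc _ = ‖F f A ω‖ ^ (2 * t) * ‖F f B ω‖ ^ (2 * t) := by ring
        _ = _ := by rw [← e1, pow_add, pow_add]; ring)
  have b4 : ∑ ω, w ω * (‖F f A ω‖ ^ t * ‖F f B ω‖ ^ t) ≤ M * Z ^ t := by
    have n0 : 0 ≤ M * Z ^ t := by positivity
    refine le_of_pow_le_pow_left₀ (n := 1 + 1) (by norm_num) n0 (b3.trans ?_)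
    rw [pow_add]
    have hw := hS.nonneg
    refine mul_le_mul (by simpa using b1) (by simpa using b2) ?_ (by positivity)
    exact pow_nonneg (Finset.sum_nonneg fun ω _ => mul_nonneg (hw ω) (by positivity)) _
  refine nt_le hS.nonneg ht (fun _ => by positivity) (by positivity) ?_
  rw [mul_pow, one_div, Real.rpow_inv_natCast_pow hM ht]
  simpa only [mul_pow] using b4

theorem Dec_step {p k l a N : ℕ} {K M : ℝ} (hp : 0 < p) (hl : 0 < l) (hlk : l < k)
    (hM : 0 ≤ M) (ha : 1 ≤ a) (haN : a ≤ N) (hD : Dec p k (N - 1) K)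
    (hB : Bil p k l a a N M) :
    Dec p k N (K + (p : ℝ) ^ (2 * a + 2) * M ^ (1 / (tri k : ℝ))) := by
  intro ι Ω _ s n f w hS
  have ht : tri k ≠ 0 := (tri_pos (by omega)).ne'
  have hw := hS.nonneg
  set t := tri k
  set q := (p : ℤ) ^ N with hq
  set C1 := s.image (fun i => n i % (p : ℤ) ^ 1) with hC1
  set D := (C1 ×ˢ C1).filter (fun x => x.1 ≠ x.2) with hDD
  set Fd : ℤ → Ω → ℝ := fun d ω => ‖F f (cl n s ((p : ℤ) ^ 1) d) ω‖ with hFd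
  have pt : ∀ ω, ‖F f s ω‖ ^ 2 ≤ (∑ d ∈ C1, Fd d ω ^ 2) + ∑ x ∈ D, Fd x.1 ω * Fd x.2 ω := by
    intro ω
    calc ‖F f s ω‖ ^ 2 ≤ (∑ d ∈ C1, Fd d ω) ^ 2 := by
          rw [F_sub f n s ((p : ℤ) ^ 1)]
          gcongr; exact norm_sum_le _ _
      _ = ∑ x ∈ C1 ×ˢ C1, Fd x.1 ω * Fd x.2 ω := by
          rw [sq, Finset.sum_mul_sum, Finset.sum_product]
      _ = (∑ x ∈ (C1 ×ˢ C1).filter (fun x => x.1 = x.2), Fd x.1 ω * Fd x.2 ω) +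
            ∑ x ∈ D, Fd x.1 ω * Fd x.2 ω := (Finset.sum_filter_add_sum_filter_not _ _ _).symm
      _ = _ := by
          congr 1
          rw [Finset.sum_filter, Finset.sum_product]
          refine Finset.sum_congr rfl fun d hd => ?_
          simp [hd, sq]
  set Z := S w t f n s q
  have hZ : 0 ≤ Z := S_nonneg hw _ _ _ _ _
  set R := M ^ (1 / (t : ℝ))
  have hR : 0 ≤ R := by positivity
  have cardle : ∀ (s' : Finset ι) (b : ℕ), ((s'.image (fun i => n i % (p : ℤ) ^ b)).card : ℝ) ≤ (p : ℝ) ^ b := by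
    intro s' b
    have := card_image_le n s' (q := (p : ℤ) ^ b) (by positivity)
    push_cast at this; exact this
  have hpair : ∀ x ∈ D, nt w t (fun ω => Fd x.1 ω * Fd x.2 ω) ≤ (p : ℝ) ^ (2 * a) * (R * Z) := by
    intro x hx
    obtain ⟨hx1, hx2⟩ := Finset.mem_filter.1 hx
    obtain ⟨hd, hd'⟩ := Finset.mem_product.1 hx1
    set I : ℤ → Finset ℤ := fun d => (cl n s ((p : ℤ) ^ 1) d).image (fun i => n i % (p : ℤ) ^ a) with hI
    have hdv : (p : ℤ) ^ 1 ∣ (p : ℤ) ^ a := pow_dvd_pow _ ha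
    have hIm : ∀ d ∈ C1, ∀ c ∈ I d, c ∈ s.image (fun i => n i % (p : ℤ) ^ a) ∧ c % (p : ℤ) ^ 1 = d := by
      intro d hd c hc
      obtain ⟨i, hi, rfl⟩ := Finset.mem_image.1 hc
      obtain ⟨j, hj, rfl⟩ := Finset.mem_image.1 hd
      refine ⟨Finset.mem_image_of_mem _ (mem_cl.1 hi).1, ?_⟩
      have := (mem_cl.1 hi).2
      beta_reduce at this ⊢
      rw [Int.emod_emod_of_dvd _ hdv, this, Int.emod_emod_of_dvd _ dvd_rfl]
    have hFdle : ∀ d ∈ C1, ∀ ω, Fd d ω ≤ ∑ c ∈ I d, ‖F f (cl n s ((p : ℤ) ^ a) c) ω‖ := by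
      intro d hd ω
      simp only [hFd]
      rw [F_sub f n _ ((p : ℤ) ^ a)]
      refine (norm_sum_le _ _).trans (le_of_eq (Finset.sum_congr rfl fun c hc => ?_))
      rw [cl_cl n s hdv]
      have := (hIm d hd c hc).2
      rw [this]
      obtain ⟨j, hj, rfl⟩ := Finset.mem_image.1 hd
      exact (Int.emod_emod_of_dvd _ dvd_rfl).symm
    calc nt w t (fun ω => Fd x.1 ω * Fd x.2 ω)
        ≤ nt w t (fun ω => ∑ y ∈ I x.1 ×ˢ I x.2, ‖F f (cl n s ((p : ℤ) ^ a) y.1) ω‖ *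
            ‖F f (cl n s ((p : ℤ) ^ a) y.2) ω‖) := by
          refine nt_mono hw ht (fun ω => by positivity) fun ω => ?_
          rw [Finset.sum_product]
          dsimp only
          rw [← Finset.sum_mul_sum]
          exact mul_le_mul (hFdle _ hd ω) (hFdle _ hd' ω) (by positivity)
            (Finset.sum_nonneg fun _ _ => by positivity)
      _ ≤ ∑ y ∈ I x.1 ×ˢ I x.2, nt w t (fun ω => ‖F f (cl n s ((p : ℤ) ^ a) y.1) ω‖ *
            ‖F f (cl n s ((p : ℤ) ^ a) y.2) ω‖) :=
          nt_sum hw ht _ (fun (y : ℤ × ℤ) ω => ‖F f (cl n s ((p : ℤ) ^ a) y.1) ω‖ *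
            ‖F f (cl n s ((p : ℤ) ^ a) y.2) ω‖) fun _ _ => by positivity
      _ ≤ ∑ y ∈ I x.1 ×ˢ I x.2, R * Z := by
          refine Finset.sum_le_sum fun y hy => ?_
          obtain ⟨hy1, hy2⟩ := Finset.mem_product.1 hy
          obtain ⟨h1, h1'⟩ := hIm _ hd _ hy1
          obtain ⟨h2, h2'⟩ := hIm _ hd' _ hy2
          refine pair_bound hl hlk hM haN hB hS h1 h2 fun h => hx2 ?_
          rw [← h1', ← h2', pow_one]
          exact emod_iff.2 h
      _ ≤ _ := by
          rw [Finset.sum_const, nsmul_eq_mul, Finset.card_product]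
          refine mul_le_mul_of_nonneg_right ?_ (by positivity)
          push_cast
          rw [two_mul, pow_add]
          exact mul_le_mul (cardle _ a) (cardle _ a) (by positivity) (by positivity)
  have hmain : N2 w t f s ≤ (∑ d ∈ C1, N2 w t f (cl n s ((p : ℤ) ^ 1) d)) +
      ∑ x ∈ D, nt w t (fun ω => Fd x.1 ω * Fd x.2 ω) := by
    refine (nt_mono hw ht (fun ω => by positivity) pt).trans ?_
    refine (nt_add hw ht (fun ω => Finset.sum_nonneg fun _ _ => by positivity)
      (fun ω => Finset.sum_nonneg fun _ _ => by positivity)).trans ?_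
    refine add_le_add ?_ ?_
    · exact nt_sum hw ht C1 (fun d ω => Fd d ω ^ 2) fun _ _ => by positivity
    · exact nt_sum hw ht D (fun x ω => Fd x.1 ω * Fd x.2 ω) fun _ _ => by positivity
  have h1 : ∑ d ∈ C1, N2 w t f (cl n s ((p : ℤ) ^ 1) d) ≤ K * Z := by
    have : Z = _ := (S_sub w t f n s (q0 := (p : ℤ) ^ 1) (q := q) (pow_dvd_pow _ (ha.trans haN))).symm
    rw [this, Finset.mul_sum]
    exact Finset.sum_le_sum fun d _ => Dec.cls hp.ne' hD (ha.trans haN) hS d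
  have h2 : ∑ x ∈ D, nt w t (fun ω => Fd x.1 ω * Fd x.2 ω) ≤ (p : ℝ) ^ (2 * a + 2) * R * Z := by
    refine (Finset.sum_le_sum hpair).trans ?_
    rw [Finset.sum_const, nsmul_eq_mul]
    have : (D.card : ℝ) ≤ (p : ℝ) ^ 2 := by
      have h3 : (D.card : ℝ) ≤ C1.card * C1.card := by
        have := Finset.card_filter_le (C1 ×ˢ C1) (fun x => x.1 ≠ x.2)
        rw [Finset.card_product] at this
        exact_mod_cast this
      refine h3.trans ?_
      rw [sq]
      have := cardle s 1
      rw [← hC1, pow_one] at this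
      exact mul_le_mul this this (by positivity) (by positivity)
    calc _ ≤ (p : ℝ) ^ 2 * ((p : ℝ) ^ (2 * a) * (R * Z)) := by gcongr
      _ = _ := by ring
  calc _ ≤ _ := hmain
    _ ≤ K * Z + (p : ℝ) ^ (2 * a + 2) * R * Z := add_le_add h1 h2
    _ = _ := by ring
end VMV


namespace VMV
open Finset

theorem rpow_pow_nat {p : ℕ} (x : ℝ) (t : ℕ) : ((p : ℝ) ^ x) ^ t = (p : ℝ) ^ ((t : ℝ) * x) := by
  rw [← Real.rpow_natCast, ← Real.rpow_mul (Nat.cast_nonneg p), mul_comm]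

theorem chain {p k l b N N0 : ℕ} {ε1 : ℝ} (hp : p.Prime) (hkp : k < p) (hl : 0 < l) (hlk : l < k)
    (hε : 0 ≤ ε1) (hD : ∀ n ≥ N0, Dec p l n ((p : ℝ) ^ (ε1 * n))) {M : ℝ} (hM : 0 ≤ M) (d : ℕ) :
    ∀ a, l * (N0 + 1) ≤ a → l * (a + d) ≤ (k - l + 1) * b → a + d ≤ N → Bil p k l (a + d) b N M →
      Bil p k l a b N ((p : ℝ) ^ ((tri l : ℝ) * (ε1 * d + N0)) * M) := by
  have hp1 : (1 : ℝ) ≤ p := by exact_mod_cast hp.one_lt.le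
  have hp0 : (0 : ℝ) < p := by linarith
  induction d using Nat.strong_induction_on with
  | _ d ih =>
    intro a ha h1 h2 hB
    have ha0 : 0 < a := lt_of_lt_of_le (by positivity) ha
    by_cases hd : l * d ≤ a
    · rw [← rpow_pow_nat]
      refine Bil.lower hp hkp hl hlk ha0 h1 hd h2 (by positivity) hM ?_ hB
      by_cases hdN : N0 ≤ d
      · refine (hD d hdN).mono (Real.rpow_le_rpow_of_exponent_le hp1 ?_)
        have : (0 : ℝ) ≤ N0 := Nat.cast_nonneg _
        linarith
      · refine (Dec_trivial hp.pos hl d).mono ?_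
        rw [← Real.rpow_natCast]
        refine Real.rpow_le_rpow_of_exponent_le hp1 ?_
        have : (d : ℝ) ≤ N0 := by exact_mod_cast (not_le.1 hdN).le
        have : 0 ≤ ε1 * d := by positivity
        linarith
    · push Not at hd
      set e := a / l with he
      have e1 : l * e ≤ a := Nat.mul_div_le a l
      have e2 : N0 + 1 ≤ e := by
        rw [he, Nat.le_div_iff_mul_le hl]; linarith
      have e3 : e < d := by
        by_contra h
        push Not at h
        have := Nat.mul_le_mul_left l h
        omega
      have hB2 := ih (d - e) (by omega) (a + e) (by omega)
        (by rw [show a + e + (d - e) = a + d by omega]; exact h1) (by omega)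
        (by rw [show a + e + (d - e) = a + d by omega]; exact hB)
      have h4 : l * (a + e) ≤ (k - l + 1) * b :=
        le_trans (Nat.mul_le_mul_left l (by omega)) h1
      have hB3 := Bil.lower hp hkp hl hlk ha0 h4 e1 (by omega) (by positivity) (by positivity)
        (hD e (by omega)) hB2
      refine hB3.mono (le_of_eq ?_)
      rw [rpow_pow_nat, ← mul_assoc, ← Real.rpow_add hp0]
      congr 2
      rw [Nat.cast_sub e3.le]; ring

/-- decoupling with exponent `lam` -/
def PP (p k : ℕ) (lam : ℝ) : Prop :=
  ∀ ε : ℝ, 0 < ε → ∃ N0 : ℕ, ∀ N ≥ N0, Dec p k N ((p : ℝ) ^ ((lam + ε) * N))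

def Sav (p k : ℕ) (lam : ℝ) (l : ℕ) (σ : ℝ) : Prop :=
  ∃ L : ℕ, 0 < L ∧ ∀ ε : ℝ, 0 < ε → ∃ b0 : ℕ, ∀ b ≥ b0, ∀ N ≥ L * b, ∀ a : ℕ, b ≤ k * a →
    l * a ≤ (k - l + 1) * b →
    Bil p k l a b N ((p : ℝ) ^ ((tri k : ℝ) * ((lam + ε) * N - σ * b)))

theorem Sav.mono {p k l : ℕ} {lam σ σ' : ℝ} (hp : 0 < p) (h : Sav p k lam l σ) (hσ : σ' ≤ σ) :
    Sav p k lam l σ' := by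
  have hp1 : (1 : ℝ) ≤ p := by exact_mod_cast hp
  obtain ⟨L, hL, h⟩ := h
  refine ⟨L, hL, fun ε hε => ?_⟩
  obtain ⟨b0, h⟩ := h ε hε
  refine ⟨b0, fun b hb N hN a h1 h2 => (h b hb N hN a h1 h2).mono ?_⟩
  refine Real.rpow_le_rpow_of_exponent_le hp1 ?_
  gcongr

theorem Sav_zero {p k : ℕ} {lam : ℝ} (hp : 0 < p) (hk : 0 < k)
    (h : PP p k lam) : Sav p k lam 0 lam := by
  have hp1 : (1 : ℝ) ≤ p := by exact_mod_cast hp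
  refine ⟨2, two_pos, fun ε hε => ?_⟩
  obtain ⟨N0, h⟩ := h ε hε
  refine ⟨N0, fun b hb N hN a h1 h2 => ?_⟩
  have hbN : b ≤ N := by omega
  refine (Bil_zero hp.ne' hk hbN (h (N - b) (by omega))).mono ?_
  rw [rpow_pow_nat, Nat.cast_sub hbN]
  refine Real.rpow_le_rpow_of_exponent_le hp1 ?_
  gcongr
  have : 0 ≤ ε * b := by positivity
  linarith

theorem Sav_triv {p k l : ℕ} {lam : ℝ} (hp : 0 < p) (hl : 0 < l) (hlk : l < k) (hlam : 0 ≤ lam)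
    (h : PP p k lam) : Sav p k lam l 0 := by
  have hp1 : (1 : ℝ) ≤ p := by exact_mod_cast hp
  have hp0 : (0 : ℝ) < p := by linarith
  refine ⟨k + 1, by omega, fun ε hε => ?_⟩
  obtain ⟨N0, h⟩ := h ε hε
  refine ⟨N0, fun b hb N hN a h1 h2 => ?_⟩
  have ha : a ≤ k * b := by
    calc a ≤ l * a := Nat.le_mul_of_pos_left a hl
      _ ≤ (k - l + 1) * b := h2
      _ ≤ k * b := Nat.mul_le_mul_right b (by omega)
  have hN' : k * b + b ≤ N := by rw [← Nat.succ_mul]; exact hN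
  have hb' : b ≤ k * b := Nat.le_mul_of_pos_left b (by omega)
  have haN : a ≤ N := by omega
  have hbN : b ≤ N := by omega
  refine (Bil_trivial hp.ne' hl hlk haN hbN (by positivity) (by positivity)
    (h (N - a) (by omega)) (h (N - b) (by omega))).mono ?_
  rw [rpow_pow_nat, rpow_pow_nat, ← Real.rpow_add hp0]
  refine Real.rpow_le_rpow_of_exponent_le hp1 ?_
  have hlt := (tri_lt hlk).le
  rw [Nat.cast_sub hlt, Nat.cast_sub haN, Nat.cast_sub hbN]
  have hlt' : (tri l : ℝ) ≤ tri k := by exact_mod_cast hlt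
  have q1 : 0 ≤ (tri l : ℝ) * ((lam + ε) * a) := by positivity
  have q2 : 0 ≤ ((tri k : ℝ) - tri l) * ((lam + ε) * b) :=
    mul_nonneg (by linarith) (by positivity)
  nlinarith

theorem Sav_step {p k l : ℕ} {lam σ1 σ2 : ℝ} (hp : p.Prime) (hkp : k < p) (hl : 0 < l) (hlk : l < k)
    (hlow : PP p l 0) (hσ1 : 0 ≤ σ1)
    (h1 : Sav p k lam (k - l) σ1) (h2 : Sav p k lam (l - 1) σ2) :
    Sav p k lam l (σ1 / l + ((k - l : ℕ) : ℝ) / ((k - l : ℕ) + 1) * σ2) := by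
  have hp1 : (1 : ℝ) ≤ p := by exact_mod_cast hp.one_lt.le
  have hp0 : (0 : ℝ) < p := by linarith
  have hk0 : 0 < k := by omega
  have hkR : (0 : ℝ) < k := by exact_mod_cast hk0
  have hlR : (0 : ℝ) < l := by exact_mod_cast hl
  obtain ⟨L1, hL1, h1⟩ := h1
  obtain ⟨L2, hL2, h2⟩ := h2
  refine ⟨L1 * k + L2 + k, by positivity, fun ε hε => ?_⟩
  obtain ⟨b1, h1⟩ := h1 (ε / 2) (by positivity)
  obtain ⟨b2, h2⟩ := h2 (ε / 2) (by positivity)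
  set ε1 := ε / (4 * k) with hε1
  have hε1p : 0 < ε1 := by positivity
  obtain ⟨N0, hlow⟩ := hlow ε1 hε1p
  simp only [zero_add] at hlow
  obtain ⟨m, hm⟩ := exists_nat_ge (4 * (N0 + σ1) / ε)
  refine ⟨k * b1 + b2 + k * (l * (N0 + 1)) + m + l, fun b hb N hN a ha1 ha2 => ?_⟩
  set r := k - l with hr
  set a' := (r + 1) * b / l with ha'
  have A1 : l * a' ≤ (r + 1) * b := Nat.mul_div_le _ _
  have A2 : (r + 1) * b < l * a' + l := by
    have := Nat.lt_mul_div_succ ((r + 1) * b) hl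
    rw [mul_add, mul_one] at this; exact this
  have A3 : a ≤ a' := by
    rw [ha', Nat.le_div_iff_mul_le hl, mul_comm]; exact ha2
  have A4 : a' ≤ k * b := by
    calc a' ≤ l * a' := Nat.le_mul_of_pos_left a' hl
      _ ≤ (r + 1) * b := A1
      _ ≤ k * b := Nat.mul_le_mul_right b (by omega)
  have A5 : r * b ≤ (l + 1) * a' := by
    have : (l + 1) * a' = l * a' + a' := by ring
    have : (r + 1) * b = r * b + b := by ring
    omega
  have A6 : b ≤ k * a' := by
    calc b ≤ r * b := Nat.le_mul_of_pos_left b (by omega)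
      _ ≤ (l + 1) * a' := A5
      _ ≤ k * a' := Nat.mul_le_mul_right _ (by omega)
  have A7 : b1 ≤ a' := by
    have : k * b1 ≤ k * a' := by omega
    exact Nat.le_of_mul_le_mul_left this hk0
  have A8 : l * (N0 + 1) ≤ a := by
    have : k * (l * (N0 + 1)) ≤ k * a := by omega
    exact Nat.le_of_mul_le_mul_left this hk0
  have hN' : L1 * k * b + L2 * b + k * b ≤ N := by
    have : (L1 * k + L2 + k) * b = L1 * k * b + L2 * b + k * b := by ring
    omega
  have A9 : L1 * a' ≤ N := by
    have := Nat.mul_le_mul_left L1 A4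
    rw [← mul_assoc] at this
    omega
  have A10 : L2 * b ≤ N := by omega
  have A11 : a' ≤ N := by omega
  have A12 : (l - 1) * a' ≤ (k - (l - 1) + 1) * b := by
    calc (l - 1) * a' ≤ l * a' := Nat.mul_le_mul_right _ (by omega)
      _ ≤ (r + 1) * b := A1
      _ ≤ _ := Nat.mul_le_mul_right _ (by omega)
  have B1 := h1 a' A7 N A9 b A4 (by rw [show k - r + 1 = l + 1 by omega]; exact A5)
  have B2 := h2 b (by omega) N A10 a' A6 A12
  set t : ℝ := (tri k : ℝ) with ht
  have rR : (0 : ℝ) < (r : ℝ) + 1 := by positivity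
  set E := t * ((lam + ε / 2) * N - (σ1 * a' + r * σ2 * b) / (r + 1)) with hE
  have B3 : Bil p k l a' b N ((p : ℝ) ^ E) := by
    refine Bil.holder hl hlk B1 B2 (by positivity) (by positivity) (by positivity) ?_
    rw [rpow_pow_nat, rpow_pow_nat, ← Real.rpow_add hp0]
    refine Real.rpow_le_rpow_of_exponent_le hp1 (le_of_eq ?_)
    rw [← hr, hE]
    push_cast
    field_simp
    ring
  have hda : a + (a' - a) = a' := by omega
  have B4 := chain hp hkp hl hlk hε1p.le hlow (M := (p : ℝ) ^ E) (by positivity) (b := b) (N := N) (a' - a) a A8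
    (by rw [hda]; exact A1) (by omega) (by rw [hda]; exact B3)
  refine B4.mono ?_
  rw [← Real.rpow_add hp0]
  refine Real.rpow_le_rpow_of_exponent_le hp1 ?_
  have hlt : (tri l : ℝ) ≤ t := by rw [ht]; exact_mod_cast (tri_lt hlk).le
  have t0 : 0 ≤ t := Nat.cast_nonneg _
  have c1 : ε1 * ((a' - a : ℕ) : ℝ) ≤ ε / 4 * N := by
    have : ((a' - a : ℕ) : ℝ) ≤ k * N := by
      have : a' - a ≤ k * N := by
        have : N ≤ k * N := Nat.le_mul_of_pos_left N hk0
        omega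
      exact_mod_cast this
    calc ε1 * ((a' - a : ℕ) : ℝ) ≤ ε1 * (k * N) := by gcongr
      _ = _ := by rw [hε1]; field_simp
  have c2 : (N0 : ℝ) + σ1 ≤ ε / 4 * N := by
    have : m ≤ N := by
      have : b ≤ k * b := Nat.le_mul_of_pos_left b hk0
      omega
    have : (m : ℝ) ≤ N := by exact_mod_cast this
    have h5 := hm.trans this
    rw [div_le_iff₀ hε] at h5
    linarith
  have c3 : σ1 / l * b - σ1 ≤ σ1 * a' / (r + 1) := by
    have q : ((r : ℝ) + 1) * b ≤ l * a' + l := by exact_mod_cast A2.le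
    have q2 : (b : ℝ) / l ≤ a' / (r + 1) + 1 := by
      rw [div_add_one rR.ne', div_le_div_iff₀ hlR rR]
      have : (l : ℝ) * 1 ≤ l * (r + 1) := by
        have : (0 : ℝ) ≤ r := Nat.cast_nonneg _
        gcongr; linarith
      nlinarith
    have := mul_le_mul_of_nonneg_left q2 hσ1
    have e1 : σ1 / l * b = σ1 * (b / l) := by ring
    have e2 : σ1 * a' / (r + 1) = σ1 * (a' / (r + 1)) := by ring
    rw [e1, e2]; linarith
  have c4 : (tri l : ℝ) * (ε1 * ((a' - a : ℕ) : ℝ) + N0) ≤ t * (ε / 4 * N + N0) := by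
    refine mul_le_mul hlt (by linarith) (by positivity) t0
  refine (add_le_add c4 le_rfl).trans ?_
  rw [hE, ← mul_add]
  refine mul_le_mul_of_nonneg_left ?_ t0
  have e3 : (σ1 * a' + r * σ2 * b) / (r + 1) = σ1 * a' / (r + 1) + r / (r + 1) * σ2 * b := by
    field_simp
  rw [e3]
  linarith
end VMV


namespace VMV
open Finset

theorem sav_sum (k : ℕ) (hk : 2 ≤ k) (lam : ℝ) (σ : ℕ → ℝ) (h0 : σ 0 = lam) :
    ∑ l ∈ Finset.Ico 1 k, (σ (k - l) / l + ((k - l : ℕ) : ℝ) / ((k - l : ℕ) + 1) * σ (l - 1)) =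
      (∑ l ∈ Finset.Ico 1 k, σ l) + ((k : ℝ) - 1) / k * lam := by
  obtain ⟨n, rfl⟩ : ∃ n, k = n + 1 := ⟨k - 1, by omega⟩
  have e1 : ∑ l ∈ Finset.Ico 1 (n + 1), σ (n + 1 - l) / (l : ℝ) =
      ∑ l ∈ Finset.Ico 1 (n + 1), σ l / ((n + 1 - l : ℕ) : ℝ) := by
    refine Finset.sum_nbij' (fun l => n + 1 - l) (fun l => n + 1 - l) ?_ ?_ ?_ ?_ ?_
    · intro l hl; simp only [Finset.mem_Ico] at *; omega
    · intro l hl; simp only [Finset.mem_Ico] at *; omega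
    · intro l hl; simp only [Finset.mem_Ico] at *; omega
    · intro l hl; simp only [Finset.mem_Ico] at *; omega
    · intro l hl; simp only [Finset.mem_Ico] at *
      rw [show n + 1 - (n + 1 - l) = l by omega]
  have e2 : ∑ l ∈ Finset.Ico 1 (n + 1), ((n + 1 - l : ℕ) : ℝ) / ((n + 1 - l : ℕ) + 1) * σ (l - 1) =
      (∑ l ∈ Finset.Ico 1 (n + 1), ((n - l : ℕ) : ℝ) / ((n - l : ℕ) + 1) * σ l) + (n : ℝ) / (n + 1) * lam := by
    rw [Finset.sum_Ico_eq_sum_range, Finset.sum_Ico_eq_sum_range]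
    have q : ∀ i, ((n + 1 - (1 + i) : ℕ) : ℝ) / ((n + 1 - (1 + i) : ℕ) + 1) * σ (1 + i - 1) =
        ((n - i : ℕ) : ℝ) / ((n - i : ℕ) + 1) * σ i := by
      intro i
      rw [show n + 1 - (1 + i) = n - i by omega, show 1 + i - 1 = i by omega]
    simp only [q, show n + 1 - 1 = n by omega]
    have a1 := Finset.sum_range_succ (fun i => ((n - i : ℕ) : ℝ) / ((n - i : ℕ) + 1) * σ i) n
    have a2 := Finset.sum_range_succ' (fun i => ((n - i : ℕ) : ℝ) / ((n - i : ℕ) + 1) * σ i) n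
    simp only [Nat.sub_self, Nat.cast_zero, zero_div, zero_mul, add_zero, Nat.sub_zero, h0] at a1 a2
    rw [← a1, a2]
    congr 1
    refine Finset.sum_congr rfl fun i _ => by rw [add_comm 1 i]
  rw [Finset.sum_add_distrib, e1, e2, ← add_assoc, ← Finset.sum_add_distrib]
  congr 1
  · refine Finset.sum_congr rfl fun l hl => ?_
    simp only [Finset.mem_Ico] at hl
    have : ((n + 1 - l : ℕ) : ℝ) = ((n - l : ℕ) : ℝ) + 1 := by
      rw [show n + 1 - l = n - l + 1 by omega]; push_cast; ring
    rw [this]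
    field_simp
    ring
  · push_cast; ring

theorem Sav_iter {p k : ℕ} {lam : ℝ} (hp : p.Prime) (hkp : k < p) (hk : 2 ≤ k) (hlam : 0 ≤ lam)
    (h : PP p k lam) (hlow : ∀ l, 0 < l → l < k → PP p l 0) (j : ℕ) :
    ∃ σ : ℕ → ℝ, σ 0 = lam ∧ (∀ l < k, 0 ≤ σ l ∧ Sav p k lam l (σ l)) ∧
      ∑ l ∈ Finset.Ico 1 k, σ l = j * (((k : ℝ) - 1) / k * lam) := by
  induction j with
  | zero =>
    refine ⟨fun l => if l = 0 then lam else 0, by simp, fun l hl => ?_, ?_⟩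
    · rcases Nat.eq_zero_or_pos l with rfl | h0
      · simpa using ⟨hlam, Sav_zero hp.pos (by omega) h⟩
      · simpa [h0.ne'] using Sav_triv hp.pos h0 hl hlam h
    · simp only [Nat.cast_zero, zero_mul]
      refine Finset.sum_eq_zero fun l hl => ?_
      simp only [Finset.mem_Ico] at hl
      rw [if_neg (by omega)]
  | succ j ih =>
    obtain ⟨σ, h0, h1, h2⟩ := ih
    refine ⟨fun l => if l = 0 then lam else
      σ (k - l) / l + ((k - l : ℕ) : ℝ) / ((k - l : ℕ) + 1) * σ (l - 1), by simp, fun l hl => ?_, ?_⟩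
    · rcases Nat.eq_zero_or_pos l with rfl | hl0
      · simpa using ⟨hlam, Sav_zero hp.pos (by omega) h⟩
      · simp only [hl0.ne', if_false]
        have s1 := h1 (k - l) (by omega)
        have s2 := h1 (l - 1) (by omega)
        have := s1.1
        have := s2.1
        exact ⟨by positivity, Sav_step hp hkp hl0 hl (hlow l hl0 hl) s1.1 s1.2 s2.2⟩
    · have := sav_sum k hk lam σ h0
      rw [h2] at this
      push_cast
      rw [add_mul, one_mul, ← this]
      refine Finset.sum_congr rfl fun l hl => ?_
      simp only [Finset.mem_Ico] at hl
      rw [if_neg (by omega)]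

theorem Sav_up {p k : ℕ} {lam : ℝ} (hp : p.Prime) (hkp : k < p) (hlam : 0 ≤ lam)
    (h : PP p k lam) (hlow : ∀ l, 0 < l → l < k → PP p l 0) (l d : ℕ) (hl : 0 < l) (B : ℝ) (hB : 0 ≤ B)
    (hS : Sav p k lam l B) : l + d < k → Sav p k lam (l + d) (B / 2 ^ d) := by
  induction d with
  | zero => intro _; simpa using hS
  | succ d ih =>
    intro hd
    have h1 := Sav_triv (l := k - (l + (d + 1))) hp.pos (by omega) (by omega) hlam h
    have h2 := ih (by omega)
    have h3 := Sav_step hp hkp (by omega) hd (hlow _ (by omega) hd) le_rfl h1 h2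
    refine h3.mono hp.pos ?_
    rw [zero_div, zero_add, pow_succ]
    have : (1 : ℝ) ≤ ((k - (l + (d + 1)) : ℕ) : ℝ) := by
      have : 1 ≤ k - (l + (d + 1)) := by omega
      exact_mod_cast this
    set r := ((k - (l + (d + 1)) : ℕ) : ℝ)
    have : (1 : ℝ) / 2 ≤ r / (r + 1) := by rw [div_le_div_iff₀ (by norm_num) (by linarith)]; linarith
    have h5 : 0 ≤ B / 2 ^ d := by positivity
    have := mul_le_mul_of_nonneg_right this h5
    calc B / (2 ^ d * 2) = 1 / 2 * (B / 2 ^ d) := by field_simp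
      _ ≤ _ := this

theorem Sav_three {p k : ℕ} {lam : ℝ} (hp : p.Prime) (hkp : k < p) (hk : 2 ≤ k) (hlam : 0 < lam)
    (h : PP p k lam) (hlow : ∀ l, 0 < l → l < k → PP p l 0) : Sav p k lam 1 3 := by
  have hkR : (2 : ℝ) ≤ k := by exact_mod_cast hk
  set B : ℝ := 3 * 2 ^ k with hB
  set δ := ((k : ℝ) - 1) / k * lam with hδ
  have hδ0 : 0 < δ := mul_pos (div_pos (by linarith) (by linarith)) hlam
  obtain ⟨j, hj⟩ := exists_nat_ge (k * B / δ)
  rw [div_le_iff₀ hδ0] at hj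
  obtain ⟨σ, h0, h1, h2⟩ := Sav_iter hp hkp hk hlam.le h hlow j
  have : ∃ l ∈ Finset.Ico 1 k, B ≤ σ l := by
    by_contra hcon
    push Not at hcon
    have h3 : ∑ l ∈ Finset.Ico 1 k, σ l < ∑ l ∈ Finset.Ico 1 k, B :=
      Finset.sum_lt_sum_of_nonempty ⟨1, by simp; omega⟩ hcon
    rw [Finset.sum_const, Nat.card_Ico, nsmul_eq_mul, h2] at h3
    have : ((k - 1 : ℕ) : ℝ) * B ≤ k * B := by
      gcongr; omega
    linarith
  obtain ⟨l, hl, hlB⟩ := this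
  simp only [Finset.mem_Ico] at hl
  have hB0 : 0 ≤ B := by positivity
  have s1 := (h1 l hl.2).2.mono hp.pos hlB
  have s2 := Sav_up hp hkp hlam.le h hlow l (k - 1 - l) (by omega) B hB0 s1 (by omega)
  rw [show l + (k - 1 - l) = k - 1 by omega] at s2
  have s3 := s2.mono (σ' := 3) hp.pos (by
    rw [hB, le_div_iff₀ (by positivity)]
    gcongr
    · norm_num
    · omega)
  have s4 := Sav_step (l := 1) hp hkp one_pos (by omega) (hlow 1 one_pos (by omega)) (by norm_num) s3
    (Sav_zero hp.pos (by omega) h)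
  refine s4.mono hp.pos ?_
  simp only [Nat.cast_one, div_one]
  have : 0 ≤ ((k - 1 : ℕ) : ℝ) / ((k - 1 : ℕ) + 1) * lam := by positivity
  linarith

theorem PP_one {p k : ℕ} (hp : 0 < p) (hk : 0 < k) : PP p k 1 := by
  have hp1 : (1 : ℝ) ≤ p := by exact_mod_cast hp
  intro ε hε
  refine ⟨0, fun N _ => (Dec_trivial hp hk N).mono ?_⟩
  rw [← Real.rpow_natCast]
  refine Real.rpow_le_rpow_of_exponent_le hp1 ?_
  have : 0 ≤ ε * N := by positivity
  linarith

theorem event_le {p : ℕ} (hp : 2 ≤ p) (C ε : ℝ) (hε : 0 < ε) :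
    ∃ N0 : ℕ, ∀ N ≥ N0, C * ((N : ℝ) + 1) ≤ (p : ℝ) ^ (ε * N) := by
  have hp1 : (1 : ℝ) < p := by exact_mod_cast hp
  have hp0 : (0 : ℝ) < p := by linarith
  set r : ℝ := (p : ℝ) ^ (-ε) with hr
  have hr1 : r < 1 := Real.rpow_lt_one_of_one_lt_of_neg hp1 (by linarith)
  have hr0 : 0 < r := by positivity
  have t1 := tendsto_pow_const_mul_const_pow_of_abs_lt_one 1 (r := r) (by rw [abs_of_pos hr0]; exact hr1)
  have t2 := tendsto_pow_const_mul_const_pow_of_abs_lt_one 0 (r := r) (by rw [abs_of_pos hr0]; exact hr1)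
  have t3 := (t1.add t2).const_mul C
  simp only [add_zero, mul_zero, pow_one, pow_zero, one_mul] at t3
  have := t3.eventually (ge_mem_nhds (show (0 : ℝ) < 1 by norm_num))
  obtain ⟨N0, hN⟩ := Filter.eventually_atTop.1 this
  refine ⟨N0, fun N hN' => ?_⟩
  have h1 := hN N hN'
  have h2 : r ^ N * (p : ℝ) ^ (ε * N) = 1 := by
    rw [hr, ← Real.rpow_natCast, ← Real.rpow_mul hp0.le, ← Real.rpow_add hp0]
    simp
  have h3 : 0 < (p : ℝ) ^ (ε * N) := by positivity
  calc C * ((N : ℝ) + 1) = (C * (N * r ^ N + r ^ N)) * (p : ℝ) ^ (ε * N) := by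
        have : (C * (N * r ^ N + r ^ N)) * (p : ℝ) ^ (ε * N) = C * (N + 1) * (r ^ N * (p : ℝ) ^ (ε * N)) := by ring
        rw [this, h2, mul_one]
    _ ≤ 1 * (p : ℝ) ^ (ε * N) := by gcongr
    _ = _ := one_mul _

theorem PP_improve {p k : ℕ} {lam : ℝ} (hp : p.Prime) (hkp : k < p) (hk : 2 ≤ k) (hlam : 0 < lam)
    (h : PP p k lam) (hlow : ∀ l, 0 < l → l < k → PP p l 0) : ∃ lam' < lam, 0 ≤ lam' ∧ PP p k lam' := by
  have hp1 : (1 : ℝ) ≤ p := by exact_mod_cast hp.one_lt.le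
  have hp0 : (0 : ℝ) < p := by linarith
  obtain ⟨L, hL, hS⟩ := Sav_three hp hkp hk hlam h hlow
  have hLR : (0 : ℝ) < L := by exact_mod_cast hL
  obtain ⟨b0, hS⟩ := hS (1 / (2 * L)) (by positivity)
  set lam' := max (lam - 1 / (2 * L)) 0 with hlam'
  have hl1 : lam - 1 / (2 * L) ≤ lam' := le_max_left _ _
  have hl0 : 0 ≤ lam' := le_max_right _ _
  have hlt : lam' < lam := by
    rw [hlam']; refine max_lt ?_ hlam
    have : 0 < 1 / (2 * (L : ℝ)) := by positivity
    linarith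
  refine ⟨lam', hlt, hl0, ?_⟩
  set N1 := L * (b0 + 1) with hN1
  have htk : (tri k : ℝ) ≠ 0 := by exact_mod_cast (tri_pos (by omega)).ne'
  have step : ∀ N ≥ N1, ∀ K, Dec p k (N - 1) K → Dec p k N (K + (p : ℝ) ^ (3 + lam' * N)) := by
    intro N hN K hK
    set a := N / L with ha
    have a1 : b0 + 1 ≤ a := by rw [ha, Nat.le_div_iff_mul_le hL]; linarith
    have a2 : L * a ≤ N := Nat.mul_div_le _ _
    have a3 : N < L * a + L := by
      have := Nat.lt_mul_div_succ N hL
      rw [mul_add, mul_one] at this; exact this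
    have a4 : a ≤ N := Nat.div_le_self _ _
    have B := hS a (by omega) N a2 a (Nat.le_mul_of_pos_left a (by omega))
      (Nat.mul_le_mul_right a (by omega))
    refine (Dec_step hp.pos one_pos (by omega) (by positivity) (by omega) a4 hK B).mono ?_
    rw [← Real.rpow_mul hp0.le, ← Real.rpow_natCast, ← Real.rpow_add hp0]
    refine add_le_add le_rfl (Real.rpow_le_rpow_of_exponent_le hp1 ?_)
    push_cast
    have e1 : (tri k : ℝ) * ((lam + 1 / (2 * L)) * N - 3 * a) * (1 / tri k) =
      (lam + 1 / (2 * L)) * N - 3 * a := by field_simp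
    rw [e1]
    have a3' : (N : ℝ) ≤ L * a + L := by exact_mod_cast a3.le
    have e2 : (N : ℝ) / L ≤ a + 1 := by rw [div_le_iff₀ hLR]; linarith
    have e3 : (lam - 1 / (2 * L)) * N ≤ lam' * N := by gcongr
    have e4 : (1 / (2 * L)) * (N : ℝ) = N / L / 2 := by field_simp
    have e5 : (lam + 1 / (2 * L)) * N - (lam - 1 / (2 * L)) * N = N / L := by field_simp; ring
    linarith
  have ind : ∀ m : ℕ, Dec p k (N1 + m) ((p : ℝ) ^ N1 + m * (p : ℝ) ^ (3 + lam' * (N1 + m : ℕ))) := by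
    intro m
    induction m with
    | zero => simpa using Dec_trivial hp.pos (by omega) N1
    | succ m ih =>
      have := step (N1 + (m + 1)) (by omega) _ (by
        rw [show N1 + (m + 1) - 1 = N1 + m by omega]; exact ih)
      refine this.mono ?_
      have q : (p : ℝ) ^ (3 + lam' * (N1 + m : ℕ)) ≤ (p : ℝ) ^ (3 + lam' * (N1 + (m + 1) : ℕ)) := by
        refine Real.rpow_le_rpow_of_exponent_le hp1 ?_
        gcongr
        omega
      have q2 := mul_le_mul_of_nonneg_left q (Nat.cast_nonneg (α := ℝ) m)
      push_cast at q2 ⊢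
      linarith
  intro ε hε
  obtain ⟨N2, hN2⟩ := event_le hp.two_le ((p : ℝ) ^ N1 + (p : ℝ) ^ (3 : ℝ)) ε hε
  refine ⟨N1 + N2, fun N hN => ?_⟩
  have d := ind (N - N1)
  rw [show N1 + (N - N1) = N by omega] at d
  refine d.mono ?_
  have h1 := hN2 N (by omega)
  rw [add_mul, Real.rpow_add hp0]
  set A := (p : ℝ) ^ N1
  set B := (p : ℝ) ^ (3 : ℝ)
  rw [Real.rpow_add hp0]
  set E := (p : ℝ) ^ (lam' * N)
  have hE : 1 ≤ E := Real.one_le_rpow hp1 (by positivity)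
  have hA : 0 ≤ A := by positivity
  have hB : 0 ≤ B := by positivity
  have hc : ((N - N1 : ℕ) : ℝ) ≤ N + 1 := by
    have : ((N - N1 : ℕ) : ℝ) ≤ N := by exact_mod_cast Nat.sub_le _ _
    linarith
  have hN0 : (0 : ℝ) ≤ N := Nat.cast_nonneg _
  calc A + ((N - N1 : ℕ) : ℝ) * (B * E) ≤ (A * ((N + 1) * E)) + (N + 1) * (B * E) := by
        refine add_le_add ?_ ?_
        · have : 1 ≤ ((N : ℝ) + 1) * E := by nlinarith
          nlinarith
        · gcongr
    _ = E * ((A + B) * (N + 1)) := by ring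
    _ ≤ _ := by gcongr

theorem PP_zero {p : ℕ} (hp : p.Prime) (k : ℕ) : 0 < k → k < p → PP p k 0 := by
  induction k using Nat.strong_induction_on with
  | _ k ih =>
    intro hk hkp
    have hp1 : (1 : ℝ) ≤ p := by exact_mod_cast hp.one_lt.le
    rcases Nat.lt_or_ge k 2 with h2 | h2
    · obtain rfl : k = 1 := by omega
      intro ε hε
      refine ⟨0, fun N _ => (Dec_one hp.pos N).mono ?_⟩
      exact Real.one_le_rpow hp1 (by positivity)
    · have hlow : ∀ l, 0 < l → l < k → PP p l 0 := fun l h0 h1 => ih l h1 h0 (by omega)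
      set T : Set ℝ := {x | 0 ≤ x ∧ PP p k x} with hT
      have hne : T.Nonempty := ⟨1, zero_le_one, PP_one hp.pos hk⟩
      have hbd : BddBelow T := ⟨0, fun x hx => hx.1⟩
      have hm0 : 0 ≤ sInf T := le_csInf hne fun x hx => hx.1
      have hm : PP p k (sInf T) := by
        intro ε hε
        obtain ⟨x, hx, hxl⟩ := exists_lt_of_csInf_lt hne (show sInf T < sInf T + ε / 2 by linarith)
        obtain ⟨N0, h⟩ := hx.2 (ε / 2) (by positivity)
        refine ⟨N0, fun N hN => (h N hN).mono (Real.rpow_le_rpow_of_exponent_le hp1 ?_)⟩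
        exact mul_le_mul_of_nonneg_right (by linarith) (Nat.cast_nonneg _)
      rcases hm0.eq_or_lt with h0 | h0
      · rw [← h0] at hm; exact hm
      · obtain ⟨x, hx1, hx2, hx3⟩ := PP_improve hp hkp h2 h0 hm hlow
        exact absurd (csInf_le hbd (show x ∈ T from ⟨hx2, hx3⟩)) (not_le.2 hx1)
end VMV


namespace VMV
open Finset Polynomial

theorem e_zero (p Q : ℕ) : e p Q 0 = 1 := by simp [e]

theorem e_sum (p Q : ℕ) {γ : Type} (s : Finset γ) (x : γ → ℤ) :
    ∏ i ∈ s, e p Q (x i) = e p Q (∑ i ∈ s, x i) := by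
  classical
  induction s using Finset.induction_on with
  | empty => simp [e_zero]
  | insert a s ha ih => rw [Finset.prod_insert ha, Finset.sum_insert ha, e_add, ih]

noncomputable def ff (p k N : ℕ) (i : ℤ) (c : Fin (k + 1) → ZMod (p ^ (k * N))) : ℂ :=
  e p (k * N) (∑ j : Fin (k + 1), ((c j).val : ℤ) * i ^ (j : ℕ))

theorem ff_add {p k N : ℕ} (hp : 0 < p) (i : ℤ) (c d : Fin (k + 1) → ZMod (p ^ (k * N)))
    (m : Fin (k + 1) → ℤ) (hm : ∀ j, ((m j : ℤ) : ZMod (p ^ (k * N))) = d j) :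
    ff p k N i (c + d) = e p (k * N) (∑ j : Fin (k + 1), m j * i ^ (j : ℕ)) * ff p k N i c := by
  have : NeZero (p ^ (k * N)) := ⟨(pow_pos hp _).ne'⟩
  unfold ff
  rw [← e_add, ← Finset.sum_add_distrib]
  refine e_congr hp.ne' ?_
  rw [← Finset.sum_sub_distrib]
  refine Finset.dvd_sum fun j _ => ?_
  have h1 : ((p : ℤ) ^ (k * N)) ∣ ((((c + d) j).val : ℤ) - (m j + ((c j).val : ℤ))) := by
    have := (ZMod.intCast_zmod_eq_zero_iff_dvd ((((c + d) j).val : ℤ) - (m j + ((c j).val : ℤ))) (p ^ (k * N))).1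
      (by push_cast; rw [hm]; simp [ZMod.natCast_zmod_val]; try ring)
    exact_mod_cast this
  have h2 : (((c + d) j).val : ℤ) * i ^ (j : ℕ) - (m j * i ^ (j : ℕ) + ((c j).val : ℤ) * i ^ (j : ℕ)) =
    ((((c + d) j).val : ℤ) - (m j + ((c j).val : ℤ))) * i ^ (j : ℕ) := by ring
  rw [h2]
  exact Dvd.dvd.mul_right h1 _

theorem ff_mul {p k N : ℕ} (hp : 0 < p) (i : ℤ) (c d : Fin (k + 1) → ZMod (p ^ (k * N))) :
    ff p k N i (c + d) = ff p k N i d * ff p k N i c := by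
  have : NeZero (p ^ (k * N)) := ⟨(pow_pos hp _).ne'⟩
  exact ff_add hp i c d (fun j => ((d j).val : ℤ)) fun j => by simp

theorem ff_sys {p k N : ℕ} (hp : 0 < p) [NeZero (p ^ (k * N))] (s : Finset ℤ) :
    Sys p k (k * N) s (fun i => i) (ff p k N) (fun _ => 1) := by
  refine ⟨fun _ => zero_le_one, fun P hP => ?_⟩
  refine ⟨Equiv.addRight (fun j : Fin (k + 1) => ((P.coeff j : ℤ) : ZMod (p ^ (k * N)))), fun _ => rfl, ?_⟩
  intro i _ c
  rw [Equiv.coe_addRight, ff_add hp i c _ (fun j => P.coeff j) fun j => rfl]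
  congr 2
  rw [Polynomial.eval_eq_sum_range' (n := k + 1) (by omega)]
  exact Fin.sum_univ_eq_sum_range (fun j => P.coeff j * i ^ j) (k + 1)

open Classical in
noncomputable def Sol (s k M : ℕ) : Finset ((Fin s → ℤ) × (Fin s → ℤ)) :=
  (Fintype.piFinset (fun _ : Fin s => Finset.Icc (1 : ℤ) M) ×ˢ
    Fintype.piFinset (fun _ : Fin s => Finset.Icc (1 : ℤ) M)).filter
    fun x : (Fin s → ℤ) × (Fin s → ℤ) => ∀ j ∈ Finset.Icc 1 k, ∑ i, x.1 i ^ j = ∑ i, x.2 i ^ j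

theorem mem_Sol {s k M : ℕ} {x : (Fin s → ℤ) × (Fin s → ℤ)} : x ∈ Sol s k M ↔
    x ∈ (Fintype.piFinset (fun _ : Fin s => Finset.Icc (1 : ℤ) M) ×ˢ
    Fintype.piFinset (fun _ : Fin s => Finset.Icc (1 : ℤ) M)) ∧
      ∀ j ∈ Finset.Icc 1 k, ∑ i, x.1 i ^ j = ∑ i, x.2 i ^ j := by
  exact @Finset.mem_filter _ _ (fun _ => Classical.propDecidable _) _ _

theorem orth {p k N s M : ℕ} (hp : 0 < p) [NeZero (p ^ (k * N))] :
    ((Sol s k M).card : ℝ) * Fintype.card (Fin (k + 1) → ZMod (p ^ (k * N))) ≤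
      ∑ c : Fin (k + 1) → ZMod (p ^ (k * N)), ‖F (ff p k N) (Finset.Icc (1 : ℤ) M) c‖ ^ (2 * s) := by
  set Ω := Fin (k + 1) → ZMod (p ^ (k * N))
  set A := Fintype.piFinset (fun _ : Fin s => Finset.Icc (1 : ℤ) M) with hA
  set G : (Fin s → ℤ) → Ω → ℂ := fun x c => ∏ i, ff p k N (x i) c with hG
  set g : (Fin s → ℤ) × (Fin s → ℤ) → Ω → ℂ := fun x c => G x.1 c * (starRingEnd ℂ) (G x.2 c) with hg
  have Gadd : ∀ x c d, G x (c + d) = G x d * G x c := by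
    intro x c d
    simp only [hG, ff_mul hp, Finset.prod_mul_distrib]
  have gadd : ∀ x c d, g x (c + d) = g x d * g x c := by
    intro x c d
    simp only [hg, Gadd, map_mul]; ring
  have Gnorm : ∀ x c, ‖G x c‖ = 1 := by
    intro x c
    simp only [hG, norm_prod, ff, norm_e, Finset.prod_const_one]
  have nsq : ∀ z : ℂ, ((‖z‖ ^ 2 : ℝ) : ℂ) = z * (starRingEnd ℂ) z := fun z => by
    rw [Complex.mul_conj, Complex.normSq_eq_norm_sq]
  have Zc : ∀ x, (∀ c, g x c = 1) → (∑ c, g x c) = (Fintype.card Ω : ℂ) := by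
    intro x hx
    simp [hx]
  have Zn : ∀ x, 0 ≤ (∑ c, g x c).re := by
    intro x
    by_cases h : ∀ c, g x c = 1
    · rw [Zc x h]; simp
    · push Not at h
      obtain ⟨d, hd⟩ := h
      have : ∑ c, g x c = g x d * ∑ c, g x c := by
        rw [Finset.mul_sum, ← Equiv.sum_comp (Equiv.addRight d)]
        refine Finset.sum_congr rfl fun c _ => ?_
        rw [Equiv.coe_addRight, gadd]
      have h0 : ∑ c, g x c = 0 := by
        by_contra hne
        exact hd (mul_right_cancel₀ hne (by rw [one_mul]; exact this.symm))
      rw [h0]; simp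
  have hsol : ∀ x ∈ Sol s k M, ∀ c, g x c = 1 := by
    intro x hx c
    have hx2 := (mem_Sol.1 hx).2
    have Geq : ∀ y : Fin s → ℤ, G y c = e p (k * N) (∑ j : Fin (k + 1), ((c j).val : ℤ) * ∑ i, y i ^ (j : ℕ)) := by
      intro y
      simp only [hG, ff]
      rw [e_sum, Finset.sum_comm]
      simp only [Finset.mul_sum]
    have : G x.1 c = G x.2 c := by
      rw [Geq, Geq]
      congr 1
      refine Finset.sum_congr rfl fun j _ => ?_
      congr 1
      rcases Nat.eq_zero_or_pos (j : ℕ) with h0 | h0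
      · simp [h0]
      · exact hx2 j (Finset.mem_Icc.2 ⟨h0, by omega⟩)
    simp only [hg]
    rw [this, ← nsq, Gnorm]; simp
  have expand : ∀ c, ((‖F (ff p k N) (Finset.Icc (1 : ℤ) M) c‖ ^ (2 * s) : ℝ) : ℂ) = ∑ x ∈ A ×ˢ A, g x c := by
    intro c
    have hF : F (ff p k N) (Finset.Icc (1 : ℤ) M) c ^ s = ∑ x ∈ A, G x c := by
      have := Finset.prod_univ_sum (fun _ : Fin s => Finset.Icc (1 : ℤ) M) (fun _ i => ff p k N i c)
      rw [Finset.prod_const, Finset.card_univ, Fintype.card_fin] at this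
      exact this
    have e1 : ‖F (ff p k N) (Finset.Icc (1 : ℤ) M) c‖ ^ (2 * s) = ‖F (ff p k N) (Finset.Icc (1 : ℤ) M) c ^ s‖ ^ 2 := by
      rw [norm_pow, ← pow_mul, mul_comm 2 s]
    rw [e1, nsq, hF, map_sum, Finset.sum_mul_sum, Finset.sum_product]
  have total : (∑ c, ‖F (ff p k N) (Finset.Icc (1 : ℤ) M) c‖ ^ (2 * s)) = ∑ x ∈ A ×ˢ A, (∑ c, g x c).re := by
    have h1 : ((∑ c, ‖F (ff p k N) (Finset.Icc (1 : ℤ) M) c‖ ^ (2 * s) : ℝ) : ℂ) = ∑ x ∈ A ×ˢ A, ∑ c, g x c := by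
      rw [Finset.sum_comm, Complex.ofReal_sum]
      exact Finset.sum_congr rfl fun c _ => expand c
    have h2 := congrArg Complex.re h1
    rw [Complex.ofReal_re, Complex.re_sum] at h2
    exact h2
  rw [total]
  calc ((Sol s k M).card : ℝ) * Fintype.card Ω = ∑ x ∈ Sol s k M, (∑ c, g x c).re := by
        rw [← nsmul_eq_mul, ← Finset.sum_const]
        refine Finset.sum_congr rfl fun x hx => ?_
        rw [Zc x (hsol x hx)]; simp
    _ ≤ _ := Finset.sum_le_sum_of_subset_of_nonneg (fun x hx => (mem_Sol.1 hx).1) fun x _ _ => Zn x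

theorem count {p k N s M : ℕ} {K : ℝ} (hp : 0 < p) (hk : 0 < k) (hM : M ≤ p ^ N) (hK : 0 ≤ K)
    (hD : Dec p k N K) (hs : tri k ≤ s) :
    ((Sol s k M).card : ℝ) ≤ K ^ tri k * (M : ℝ) ^ (2 * s - tri k) := by
  have : NeZero (p ^ (k * N)) := ⟨(pow_pos hp _).ne'⟩
  set Ω := Fin (k + 1) → ZMod (p ^ (k * N)) with hΩ
  set t := tri k
  have ht : t ≠ 0 := (tri_pos hk).ne'
  set s0 := Finset.Icc (1 : ℤ) M with hs0
  set V : ℝ := (Fintype.card Ω : ℝ) with hV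
  have hV0 : 0 < V := by
    rw [hV]; exact_mod_cast Fintype.card_pos
  have hcard : s0.card = M := by simp [hs0]
  have Fle : ∀ (s' : Finset ℤ) (c : Ω), ‖F (ff p k N) s' c‖ ≤ s'.card := by
    intro s' c
    refine (norm_sum_le _ _).trans ?_
    simp [ff, norm_e]
  have hsys := ff_sys (p := p) (k := k) (N := N) hp s0
  have h1 := hD ℤ Ω s0 (fun i => i) (ff p k N) (fun _ => 1) hsys
  set q := (p : ℤ) ^ N with hq
  have hqM : (M : ℤ) ≤ q := by rw [hq]; exact_mod_cast hM
  have clc : ∀ ξ, (cl (fun i => i) s0 q ξ).card ≤ 1 := by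
    intro ξ
    refine Finset.card_le_one.2 fun a ha b hb => ?_
    have ha' := mem_cl.1 ha
    have hb' := mem_cl.1 hb
    have hd : q ∣ a - b := emod_iff.1 (ha'.2.trans hb'.2.symm)
    have a1 := Finset.mem_Icc.1 ha'.1
    have b1 := Finset.mem_Icc.1 hb'.1
    have := Int.eq_zero_of_abs_lt_dvd hd (by rw [abs_lt]; constructor <;> linarith)
    linarith
  have N2le : ∀ ξ, N2 (fun _ : Ω => (1 : ℝ)) t (ff p k N) (cl (fun i => i) s0 q ξ) ≤ V ^ (1 / (t : ℝ)) := by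
    intro ξ
    refine le_of_pow_le_pow_left₀ ht (by positivity) ?_
    rw [N2_pow hsys.nonneg ht, one_div, Real.rpow_inv_natCast_pow hV0.le ht]
    calc _ ≤ ∑ c : Ω, (1 : ℝ) := by
          refine Finset.sum_le_sum fun c _ => ?_
          rw [one_mul]
          refine pow_le_one₀ (norm_nonneg _) ((Fle _ c).trans ?_)
          exact_mod_cast clc ξ
      _ = V := by simp [hV]
  have hS : S (fun _ : Ω => (1 : ℝ)) t (ff p k N) (fun i => i) s0 q ≤ M * V ^ (1 / (t : ℝ)) := by
    unfold S
    refine (Finset.sum_le_sum fun c _ => N2le c).trans ?_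
    rw [Finset.sum_const, nsmul_eq_mul]
    refine mul_le_mul_of_nonneg_right ?_ (by positivity)
    have := Finset.card_image_le (s := s0) (f := fun i => i % q)
    rw [hcard] at this
    exact_mod_cast this
  have h2 : ∑ c : Ω, ‖F (ff p k N) s0 c‖ ^ (2 * t) ≤ K ^ t * (M : ℝ) ^ t * V := by
    have h3 := h1.trans (mul_le_mul_of_nonneg_left hS hK)
    have h4 := pow_le_pow_left₀ (N2_nonneg hsys.nonneg _ _ _) h3 t
    rw [N2_pow hsys.nonneg ht, mul_pow, mul_pow, one_div, Real.rpow_inv_natCast_pow hV0.le ht] at h4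
    simp only [one_mul] at h4
    linarith
  have h5 : ∑ c : Ω, ‖F (ff p k N) s0 c‖ ^ (2 * s) ≤ (M : ℝ) ^ (2 * s - 2 * t) * (K ^ t * (M : ℝ) ^ t * V) := by
    refine le_trans ?_ (mul_le_mul_of_nonneg_left h2 (by positivity))
    rw [Finset.mul_sum]
    refine Finset.sum_le_sum fun c _ => ?_
    have e1 : 2 * s = (2 * s - 2 * t) + 2 * t := by omega
    conv_lhs => rw [e1, pow_add]
    have := Fle s0 c
    rw [hcard] at this
    gcongr
  have h6 := (orth (p := p) (k := k) (N := N) (s := s) (M := M) hp).trans h5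
  have e2 : (M : ℝ) ^ (2 * s - 2 * t) * (K ^ t * (M : ℝ) ^ t * V) = (K ^ t * (M : ℝ) ^ (2 * s - t)) * V := by
    rw [show 2 * s - t = (2 * s - 2 * t) + t by omega, pow_add]; ring
  rw [e2] at h6
  exact le_of_mul_le_mul_right h6 hV0

theorem final_bound (k s : ℕ) (hk : 3 ≤ k) (hs : s ≥ k * (k - 1)) (ε : ℝ) (hε : ε > 0) :
    ∃ C : ℝ, ∀ X : ℝ, X ≥ 1 →
      ((Sol s k ⌊X⌋₊).card : ℝ) ≤ C * X ^ (2 * (s : ℝ) - k * (k + 1) / 2 + ε) := by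
  obtain ⟨p, hkp, hp⟩ := Nat.exists_infinite_primes (k + 1)
  have hp1 : (1 : ℝ) ≤ p := by exact_mod_cast hp.one_lt.le
  have hp0 : (0 : ℝ) < p := by linarith
  set t := tri k with ht
  have ht0 : 0 < t := tri_pos (by omega)
  have htR : (0 : ℝ) < t := by exact_mod_cast ht0
  have hts : t ≤ s := by
    have h1 := two_tri k
    obtain ⟨m, rfl⟩ : ∃ m, k = m + 3 := ⟨k - 3, by omega⟩
    rw [show m + 3 - 1 = m + 2 by omega] at hs
    nlinarith
  have htr : (t : ℝ) = k * (k + 1) / 2 := by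
    have h1 : (2 : ℝ) * t = k * (k + 1) := by exact_mod_cast two_tri k
    linarith
  obtain ⟨N0, hN0⟩ := PP_zero hp k (by omega) (by omega) (ε / t) (by positivity)
  refine ⟨(p : ℝ) ^ (ε * N0) * (p : ℝ) ^ ε, fun X hX => ?_⟩
  set M := ⌊X⌋₊ with hM
  have hM1 : 1 ≤ M := Nat.le_floor (by simpa using hX)
  have hMR : (1 : ℝ) ≤ M := by exact_mod_cast hM1
  have hMX : (M : ℝ) ≤ X := Nat.floor_le (by linarith)
  set c := Nat.clog p M with hc
  have hMc : M ≤ p ^ c := Nat.le_pow_clog hp.one_lt M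
  have hcM : p ^ c ≤ p * M := by
    rcases hM1.eq_or_lt with h | h
    · rw [hc, ← h]; simp; exact hp.one_lt.le
    · have h2 := Nat.pow_pred_clog_lt_self hp.one_lt h
      have h3 : 0 < c := Nat.clog_pos hp.one_lt h
      rw [← hc] at h2
      obtain ⟨c', hc'⟩ : ∃ c', c = c' + 1 := ⟨c - 1, by omega⟩
      rw [hc'] at h2 ⊢
      simp only [Nat.pred_succ] at h2
      rw [pow_succ, mul_comm]
      exact Nat.mul_le_mul_left _ h2.le
  have hcMR : (p : ℝ) ^ c ≤ p * M := by exact_mod_cast hcM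
  have h1 := count (s := s) (M := M) hp.pos (by omega)
    (hMc.trans (Nat.pow_le_pow_right hp.pos (Nat.le_add_left c N0))) (by positivity) (hN0 (N0 + c) (by omega)) hts
  refine h1.trans ?_
  rw [rpow_pow_nat]
  have e1 : ((tri k : ℕ) : ℝ) * ((0 + ε / t) * (N0 + c : ℕ)) = ε * N0 + c * ε := by
    rw [← ht]; push_cast; field_simp; ring
  rw [e1, Real.rpow_add hp0, Real.rpow_mul hp0.le (c : ℝ) ε, Real.rpow_natCast (p : ℝ) c]
  have e2 : ((p : ℝ) ^ c) ^ ε ≤ (p : ℝ) ^ ε * (M : ℝ) ^ ε := by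
    rw [← Real.mul_rpow hp0.le (by linarith)]
    exact Real.rpow_le_rpow (by positivity) hcMR hε.le
  have e3 : (M : ℝ) ^ ε * (M : ℝ) ^ (2 * s - t) ≤ X ^ (2 * (s : ℝ) - k * (k + 1) / 2 + ε) := by
    rw [← Real.rpow_natCast, ← Real.rpow_add (by linarith), Nat.cast_sub (by omega), htr]
    push_cast
    have hts' : (t : ℝ) ≤ s := by exact_mod_cast hts
    rw [show ε + (2 * (s : ℝ) - k * (k + 1) / 2) = 2 * (s : ℝ) - k * (k + 1) / 2 + ε by ring]
    refine Real.rpow_le_rpow (by linarith) hMX ?_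
    rw [← htr]
    have : (0 : ℝ) ≤ s := Nat.cast_nonneg _
    linarith
  calc (p : ℝ) ^ (ε * N0) * ((p : ℝ) ^ c) ^ ε * (M : ℝ) ^ (2 * s - t)
      ≤ (p : ℝ) ^ (ε * N0) * ((p : ℝ) ^ ε * (M : ℝ) ^ ε) * (M : ℝ) ^ (2 * s - t) := by gcongr
    _ = (p : ℝ) ^ (ε * N0) * (p : ℝ) ^ ε * ((M : ℝ) ^ ε * (M : ℝ) ^ (2 * s - t)) := by ring
    _ ≤ _ := by gcongr
end VMV

theorem main_conjecture_large_s (k s : ℕ) (hk : 3 ≤ k) (hs : s ≥ k * (k - 1))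
    (ε : ℝ) (hε : ε > 0) :
    ∃ C : ℝ, ∀ X : ℝ, X ≥ 1 →
      (J s k X : ℝ) ≤ C * X ^ (2 * (s : ℝ) - k * (k + 1) / 2 + ε) := by
  
  obtain ⟨C, hC⟩ := VMV.final_bound k s hk hs ε hε
  refine ⟨C, fun X hX => le_trans ?_ (hC X hX)⟩
  have h : J s k X ≤ (VMV.Sol s k ⌊X⌋₊).card := by
    unfold J
    rw [← Set.ncard_coe_finset]
    refine Set.ncard_le_ncard ?_ (Finset.finite_toSet _)
    rintro ⟨x, y⟩ ⟨h1, h2, h3⟩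
    have key : ∀ z : ℤ, 1 ≤ z → (z : ℝ) ≤ X → z ≤ (⌊X⌋₊ : ℤ) := by
      intro z hz hzX
      have : z.toNat ≤ ⌊X⌋₊ := by
        refine Nat.le_floor ?_
        have e : ((z.toNat : ℤ) : ℝ) = (z : ℝ) := by rw [Int.toNat_of_nonneg (by omega)]
        have e' : ((z.toNat : ℕ) : ℝ) = (z : ℝ) := by exact_mod_cast e
        rw [e']; exact hzX
      omega
    refine Finset.mem_coe.2 (VMV.mem_Sol.2 ⟨Finset.mem_product.2 ⟨?_, ?_⟩, h3⟩)
    · exact Fintype.mem_piFinset.2 fun i => Finset.mem_Icc.2 ⟨(h1 i).1, key _ (h1 i).1 (h1 i).2⟩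
    · exact Fintype.mem_piFinset.2 fun i => Finset.mem_Icc.2 ⟨(h2 i).1, key _ (h2 i).1 (h2 i).2⟩
  exact_mod_cast h
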